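/- arXiv:2112.11970 — 2 statements merged into one kernel-verified Lean document; each statement's English description precedes it below -/
import Mathlib

section
/- No subdivision of K_5 is a Burling graph. -/
namespace BurlingFormal

open SimpleGraph

/-- An orientation of a simple graph, given as a relation choosing a direction for each edge. -/
def IsOrientation {V : Type} (G : SimpleGraph V) (A : V → V → Prop) : Prop :=
  (∀ u v, A u v → G.Adj u v) ∧ (∀ u v, G.Adj u v → (A u v ↔ ¬ A v u))

/-- A chordless cycle: a cycle such that every adjacency between its vertices is a cycle edge. -/
def IsChordlessCycle {V : Type} (G : SimpleGraph V) {v : V} (c : G.Walk v v) : Prop :=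
  c.IsCycle ∧ ∀ x y, x ∈ c.support → y ∈ c.support → G.Adj x y → s(x, y) ∈ c.edges

/-- A hole: a chordless cycle of length at least 4. -/
def IsHole {V : Type} (G : SimpleGraph V) {v : V} (c : G.Walk v v) : Prop :=
  IsChordlessCycle G c ∧ 4 ≤ c.length

/-- A source of a hole w.r.t. an orientation: both its neighbours on the hole are out-neighbours. -/
def IsHoleSource {V : Type} {G : SimpleGraph V} {v : V} (A : V → V → Prop)
    (c : G.Walk v v) (x : V) : Prop :=
  x ∈ c.support ∧ ∀ y, s(x, y) ∈ c.edges → A x y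

/-- A sink of a hole w.r.t. an orientation: both its neighbours on the hole are in-neighbours. -/
def IsHoleSink {V : Type} {G : SimpleGraph V} {v : V} (A : V → V → Prop)
    (c : G.Walk v v) (x : V) : Prop :=
  x ∈ c.support ∧ ∀ y, s(x, y) ∈ c.edges → A y x

/-- An extremum of a hole: a source or a sink of it. -/
def IsHoleExtremum {V : Type} {G : SimpleGraph V} {v : V} (A : V → V → Prop)
    (c : G.Walk v v) (x : V) : Prop :=
  IsHoleSource A c x ∨ IsHoleSink A c x

/-- The hole has exactly two sources and exactly two sinks. -/
def TwoSourcesTwoSinks {V : Type} {G : SimpleGraph V} {v : V} (A : V → V → Prop)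
    (c : G.Walk v v) : Prop :=
  (∃ s₁ s₂, s₁ ≠ s₂ ∧ IsHoleSource A c s₁ ∧ IsHoleSource A c s₂ ∧
    ∀ s, IsHoleSource A c s → s = s₁ ∨ s = s₂) ∧
  (∃ t₁ t₂, t₁ ≠ t₂ ∧ IsHoleSink A c t₁ ∧ IsHoleSink A c t₂ ∧
    ∀ t, IsHoleSink A c t → t = t₁ ∨ t = t₂)

/-- The pivot of a hole: a sink adjacent on the hole to all of its sources. -/
def IsHolePivot {V : Type} {G : SimpleGraph V} {v : V} (A : V → V → Prop)
    (c : G.Walk v v) (x : V) : Prop :=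
  IsHoleSink A c x ∧ ∀ y, IsHoleSource A c y → s(x, y) ∈ c.edges

/-- A subordinate vertex of a hole: neither an antenna (source) nor the pivot. -/
def IsHoleSubordinate {V : Type} {G : SimpleGraph V} {v : V} (A : V → V → Prop)
    (c : G.Walk v v) (x : V) : Prop :=
  x ∈ c.support ∧ ¬ IsHoleSource A c x ∧ ¬ IsHolePivot A c x

/-- `S` is the vertex set of a (possibly empty) branch (downward path) starting at `u`
in the rooted tree given by the parent function. -/
def IsBranchFrom {V : Type} (parent : V → V) (u : V) (S : Set V) : Prop :=
  S = ∅ ∨ (u ∈ S ∧ (∀ w ∈ S, w ≠ u → parent w ∈ S ∧ parent w ≠ w) ∧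
    ∀ w ∈ S, ∀ w' ∈ S, w ≠ u → w' ≠ u → parent w = parent w' → w = w')

/-- A Burling tree: a rooted tree (given by a parent function) together with a last-born
function and a choose function assigning to each non-last-born non-root vertex the vertex set
of a branch starting at the last-born of its parent. -/
structure BurlingTree (V : Type) where
  parent : V → V
  root : V
  parent_root : parent root = root
  reach : ∀ v, ∃ n, parent^[n] v = root
  lastBorn : V → V
  lastBorn_child : ∀ v, (∃ u, u ≠ v ∧ parent u = v) → parent (lastBorn v) = v ∧ lastBorn v ≠ v
  choosePath : V → Set V
  choosePath_empty : ∀ v, v = root ∨ v = lastBorn (parent v) → choosePath v = ∅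
  choosePath_branch : ∀ v, v ≠ root → v ≠ lastBorn (parent v) →
    IsBranchFrom parent (lastBorn (parent v)) (choosePath v)

/-- The arcs of the oriented graph fully derived from a Burling tree. -/
def BurlingTree.Arc {V : Type} (T : BurlingTree V) (u v : V) : Prop :=
  v ∈ T.choosePath u

/-- `A` orients `G` so that `G` with this orientation is an oriented graph derived from
some Burling tree (an oriented Burling graph). -/
def IsOrientedBurling {W : Type} (G : SimpleGraph W) (A : W → W → Prop) : Prop :=
  IsOrientation G A ∧
    ∃ (V : Type) (T : BurlingTree V) (f : W ↪ V), ∀ u v, A u v ↔ T.Arc (f u) (f v)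

/-- A Burling graph (equivalently, a derived graph): the underlying graph of an oriented
graph derived from a Burling tree. -/
def IsBurlingGraph {W : Type} (G : SimpleGraph W) : Prop :=
  ∃ A, IsOrientedBurling G A

/-- A global subordinate vertex of a Burling graph: subordinate in some hole, for every
orientation of the graph as an oriented Burling graph. -/
def IsGlobalSubordinate {W : Type} (G : SimpleGraph W) (x : W) : Prop :=
  ∀ A, IsOrientedBurling G A →
    ∃ (v : W) (c : G.Walk v v), IsHole G c ∧ IsHoleSubordinate A c x

/-- `H` is a subdivision of `G` via the branch-vertex embedding `f` and the system of
paths `P` replacing the edges of `G`. -/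
def IsSubdivisionVia {V W : Type} (H : SimpleGraph W) (G : SimpleGraph V) (f : V ↪ W)
    (P : ∀ ⦃u v : V⦄, G.Adj u v → H.Walk (f u) (f v)) : Prop :=
  (∀ ⦃u v⦄ (h : G.Adj u v), (P h).IsPath ∧ 1 ≤ (P h).length) ∧
  (∀ ⦃u v⦄ (h : G.Adj u v) (x : V), f x ∈ (P h).support → x = u ∨ x = v) ∧
  (∀ ⦃u v u' v'⦄ (h : G.Adj u v) (h' : G.Adj u' v'), s(u, v) ≠ s(u', v') →
    ∀ w, w ∈ (P h).support → w ∈ (P h').support → ∃ x : V, w = f x) ∧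
  (∀ w : W, ∃ u v, ∃ h : G.Adj u v, w ∈ (P h).support) ∧
  (∀ ⦃x y : W⦄, H.Adj x y → ∃ u v, ∃ h : G.Adj u v, s(x, y) ∈ (P h).edges)

/-- `H` is a subdivision of `G`. -/
def IsSubdivision {V W : Type} (H : SimpleGraph W) (G : SimpleGraph V) : Prop :=
  ∃ (f : V ↪ W) (P : ∀ ⦃u v : V⦄, G.Adj u v → H.Walk (f u) (f v)), IsSubdivisionVia H G f P

/-- `G` contains an induced copy of `H`. -/
def InducedCopy {V W : Type} (H : SimpleGraph W) (G : SimpleGraph V) : Prop :=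
  ∃ f : W ↪ V, ∀ a b, H.Adj a b ↔ G.Adj (f a) (f b)

/-- The clique number of a graph. -/
noncomputable def cliqueNumber {V : Type} (G : SimpleGraph V) : ℕ :=
  sSup {n | ∃ s : Finset V, G.IsNClique n s}

/-- `G` belongs to `Forb*(H)`: it has no induced subdivision of `H`. -/
def InForbs {VH V : Type} (H : SimpleGraph VH) (G : SimpleGraph V) : Prop :=
  ∀ (U : Type) (S : SimpleGraph U), IsSubdivision S H → ¬ InducedCopy S G

/-- `H` is weakly pervasive: the class `Forb*(H)` (of finite graphs) is χ-bounded. -/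
def WeaklyPervasive {VH : Type} (H : SimpleGraph VH) : Prop :=
  ∃ f : ℕ → ℕ, ∀ (V : Type) (_ : Fintype V) (G : SimpleGraph V),
    InForbs H G → G.chromaticNumber ≤ (f (cliqueNumber G) : ℕ∞)

/-- `G` has a star cutset centered at `v`. -/
def HasStarCutsetAt {V : Type} (G : SimpleGraph V) (v : V) : Prop :=
  ∃ S : Set V, v ∈ S ∧ (∀ u ∈ S, u = v ∨ G.Adj v u) ∧ ¬ (G.induce Sᶜ).Preconnected

/-- `G` has a star cutset. -/
def HasStarCutset {V : Type} (G : SimpleGraph V) : Prop :=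
  ∃ v, HasStarCutsetAt G v

/-- The structure of an `m`-necklace on the graph `G`: beads `B i` (chordless cycles of
length at least 4 through the non-adjacent vertices `a i`, `b i`) joined cyclically by
paths `P i` from `b i` to `a (i+1)` (of length possibly 0, i.e. identification),
with no further vertices or edges. -/
structure Necklace {V : Type} (G : SimpleGraph V) (m : ℕ) where
  a : ZMod m → V
  b : ZMod m → V
  B : ∀ i, G.Walk (a i) (a i)
  P : ∀ i, G.Walk (b i) (a (i + 1))
  B_cycle : ∀ i, (B i).IsCycle
  B_len : ∀ i, 4 ≤ (B i).length
  b_mem : ∀ i, b i ∈ (B i).support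
  ab_ne : ∀ i, a i ≠ b i
  ab_nonadj : ∀ i, ¬ G.Adj (a i) (b i)
  P_path : ∀ i, (P i).IsPath
  bead_disjoint : ∀ i j, i ≠ j → ∀ x, x ∈ (B i).support → x ∈ (B j).support →
    (j = i + 1 ∧ x = b i ∧ x = a j) ∨ (i = j + 1 ∧ x = b j ∧ x = a i)
  path_bead_disjoint : ∀ i j (x : V), x ∈ (P i).support → x ∈ (B j).support →
    x = b i ∨ x = a (i + 1)
  path_disjoint : ∀ i j, i ≠ j → ∀ x, x ∈ (P i).support → x ∈ (P j).support →
    (x = b i ∨ x = a (i + 1)) ∧ (x = b j ∨ x = a (j + 1))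
  cover_vertex : ∀ x : V, (∃ i, x ∈ (B i).support) ∨ ∃ i, x ∈ (P i).support
  cover_edge : ∀ x y, G.Adj x y → (∃ i, s(x, y) ∈ (B i).edges) ∨ ∃ i, s(x, y) ∈ (P i).edges

/-- The bead `B i` of a necklace is short if `a i` and `b i` have a common neighbour. -/
def Necklace.Short {V : Type} {G : SimpleGraph V} {m : ℕ} (N : Necklace G m)
    (i : ZMod m) : Prop :=
  ∃ w, G.Adj (N.a i) w ∧ G.Adj (N.b i) w

/-- A chandelier: an in-tree (given by a parent function on `V \ {hub}`) with at least two
leaves, together with an extra vertex `hub` joined to all the leaves. -/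
structure Chandelier (V : Type) where
  hub : V
  root : V
  parent : V → V
  hub_ne_root : hub ≠ root
  parent_root : parent root = root
  parent_hub : parent hub = hub
  parent_ne_hub : ∀ u, u ≠ hub → parent u ≠ hub
  reach : ∀ u, u ≠ hub → ∃ n, parent^[n] u = root
  two_leaves : ∃ l₁ l₂ : V, l₁ ≠ l₂ ∧
    (l₁ ≠ hub ∧ l₁ ≠ root ∧ ∀ w, parent w = l₁ → w = l₁) ∧
    (l₂ ≠ hub ∧ l₂ ≠ root ∧ ∀ w, parent w = l₂ → w = l₂)

/-- A leaf of the in-tree of a chandelier. -/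
def Chandelier.IsLeaf {V : Type} (C : Chandelier V) (u : V) : Prop :=
  u ≠ C.hub ∧ u ≠ C.root ∧ ∀ w, C.parent w = u → w = u

/-- The arcs of (the oriented version of) a chandelier. -/
def Chandelier.Arc {V : Type} (C : Chandelier V) (u w : V) : Prop :=
  (u ≠ C.hub ∧ u ≠ C.root ∧ w = C.parent u) ∨ (C.IsLeaf u ∧ w = C.hub)

/-- The underlying (non-oriented) graph of a chandelier. -/
def Chandelier.graph {V : Type} (C : Chandelier V) : SimpleGraph V :=
  SimpleGraph.fromRel C.Arc

/-- There is a vertex lying on every cycle of the graph. -/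
def HasUniversalCycleVertex {V : Type} (G : SimpleGraph V) : Prop :=
  ∃ x : V, ∀ (w : V) (c : G.Walk w w), c.IsCycle → x ∈ c.support

/-- A Burling-admissible type-4 subdivision of `K₄` sitting inside `G`: branch vertices
`x, y, z, w`, where the two non-subdivided edges `xy`, `xz` share the endpoint `x`, and the
four other edges are replaced by internally disjoint paths of length at least 2. -/
structure Type4K4Core {V : Type} (G : SimpleGraph V) where
  x : V
  y : V
  z : V
  w : V
  ne_xy : x ≠ y
  ne_xz : x ≠ z
  ne_xw : x ≠ w
  ne_yz : y ≠ z
  ne_yw : y ≠ w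
  ne_zw : z ≠ w
  adj_xy : G.Adj x y
  adj_xz : G.Adj x z
  Pxw : G.Walk x w
  Pyz : G.Walk y z
  Pyw : G.Walk y w
  Pzw : G.Walk z w
  Pxw_path : Pxw.IsPath
  Pyz_path : Pyz.IsPath
  Pyw_path : Pyw.IsPath
  Pzw_path : Pzw.IsPath
  Pxw_len : 2 ≤ Pxw.length
  Pyz_len : 2 ≤ Pyz.length
  Pyw_len : 2 ≤ Pyw.length
  Pzw_len : 2 ≤ Pzw.length
  d₁ : ∀ v, v ∈ Pxw.support → v ∈ Pyz.support → False
  d₂ : ∀ v, v ∈ Pxw.support → v ∈ Pyw.support → v = w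
  d₃ : ∀ v, v ∈ Pxw.support → v ∈ Pzw.support → v = w
  d₄ : ∀ v, v ∈ Pyz.support → v ∈ Pyw.support → v = y
  d₅ : ∀ v, v ∈ Pyz.support → v ∈ Pzw.support → v = z
  d₆ : ∀ v, v ∈ Pyw.support → v ∈ Pzw.support → v = w

/-- The vertex set of a type-4 `K₄`-subdivision configuration. -/
def Type4K4Core.supp {V : Type} {G : SimpleGraph V} (c : Type4K4Core G) : Set V :=
  {v | v ∈ c.Pxw.support ∨ v ∈ c.Pyz.support ∨ v ∈ c.Pyw.support ∨ v ∈ c.Pzw.support}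

/-- The edge set of a type-4 `K₄`-subdivision configuration. -/
def Type4K4Core.edges {V : Type} {G : SimpleGraph V} (c : Type4K4Core G) : Set (Sym2 V) :=
  {e | e ∈ c.Pxw.edges ∨ e ∈ c.Pyz.edges ∨ e ∈ c.Pyw.edges ∨ e ∈ c.Pzw.edges ∨
    e = s(c.x, c.y) ∨ e = s(c.x, c.z)}

/-- The configuration exhausts the whole graph `G`. -/
def Type4K4Core.Spanning {V : Type} {G : SimpleGraph V} (c : Type4K4Core G) : Prop :=
  (∀ v : V, v ∈ c.supp) ∧ ∀ u v, G.Adj u v → s(u, v) ∈ c.edges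

/-- A vertex of degree exactly 2. -/
def DegTwo {V : Type} (G : SimpleGraph V) (x : V) : Prop :=
  ∃ p q, p ≠ q ∧ G.Adj x p ∧ G.Adj x q ∧ ∀ r, G.Adj x r → r = p ∨ r = q


/-! ### Tree side -/

def tle {V : Type} (T : BurlingTree V) (x v : V) : Prop := ∃ n, T.parent^[n] x = v

def tlt {V : Type} (T : BurlingTree V) (x v : V) : Prop := tle T x v ∧ x ≠ v

theorem tle_refl {V : Type} (T : BurlingTree V) (x : V) : tle T x x := ⟨0, rfl⟩

theorem tle_parent {V : Type} (T : BurlingTree V) (x : V) : tle T x (T.parent x) := ⟨1, rfl⟩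

theorem tle_trans {V : Type} (T : BurlingTree V) {x y z : V} (h : tle T x y) (h' : tle T y z) :
    tle T x z := by
  obtain ⟨n, rfl⟩ := h
  obtain ⟨m, rfl⟩ := h'
  exact ⟨m + n, by rw [Function.iterate_add_apply]⟩

theorem iter_root {V : Type} (T : BurlingTree V) (n : ℕ) : T.parent^[n] T.root = T.root :=
  Function.iterate_fixed T.parent_root n

theorem periodic_root {V : Type} (T : BurlingTree V) {x : V} {k : ℕ} (hk : 0 < k)
    (h : T.parent^[k] x = x) : x = T.root := by
  obtain ⟨n, hn⟩ := T.reach x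
  have h1 : T.parent^[k * n] x = x := by
    rw [Function.iterate_mul]
    exact Function.iterate_fixed h n
  have h2 : n ≤ k * n := Nat.le_mul_of_pos_left n hk
  obtain ⟨m, hm⟩ := Nat.exists_eq_add_of_le h2
  rw [hm, Nat.add_comm, Function.iterate_add_apply, hn, iter_root] at h1
  exact h1.symm

theorem tle_antisymm {V : Type} (T : BurlingTree V) {x y : V} (h : tle T x y) (h' : tle T y x) :
    x = y := by
  obtain ⟨n, hn⟩ := h
  obtain ⟨m, hm⟩ := h'
  rcases Nat.eq_zero_or_pos n with h0 | h0
  · subst h0; exact hn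
  · have : T.parent^[m + n] x = x := by rw [Function.iterate_add_apply, hn, hm]
    have hx := periodic_root T (by omega) this
    rw [hx, iter_root] at hn
    rw [hx, hn]

theorem tle_step {V : Type} (T : BurlingTree V) {x v : V} (h : tle T x v) (hne : x ≠ v) :
    tle T (T.parent x) v := by
  obtain ⟨n, hn⟩ := h
  cases n with
  | zero => exact absurd hn hne
  | succ n => exact ⟨n, by rw [← hn, Function.iterate_succ_apply]⟩

theorem tle_linear {V : Type} (T : BurlingTree V) {x v w : V} (h : tle T x v) (h' : tle T x w) :
    tle T v w ∨ tle T w v := by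
  obtain ⟨n, rfl⟩ := h
  obtain ⟨m, rfl⟩ := h'
  rcases Nat.le_total n m with h | h
  · left
    obtain ⟨k, rfl⟩ := Nat.exists_eq_add_of_le h
    exact ⟨k, by rw [← Function.iterate_add_apply, Nat.add_comm]⟩
  · right
    obtain ⟨k, rfl⟩ := Nat.exists_eq_add_of_le h
    exact ⟨k, by rw [← Function.iterate_add_apply, Nat.add_comm]⟩

theorem tlt_trans {V : Type} (T : BurlingTree V) {x y z : V} (h : tlt T x y) (h' : tlt T y z) :
    tlt T x z := by
  refine ⟨tle_trans T h.1 h'.1, ?_⟩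
  rintro rfl
  exact h.2 (tle_antisymm T h.1 h'.1)

theorem branch_le {V : Type} (T : BurlingTree V) {u : V} {S : Set V}
    (hS : ∀ w ∈ S, w ≠ u → T.parent w ∈ S ∧ T.parent w ≠ w) :
    ∀ w ∈ S, tle T w u := by
  intro w hw
  obtain ⟨n, hn⟩ := T.reach w
  induction n generalizing w with
  | zero =>
    by_cases h : w = u
    · subst h; exact tle_refl T w
    · exfalso
      apply (hS w hw h).2
      simp only [Function.iterate_zero, id] at hn
      rw [hn, T.parent_root]
  | succ n ih =>
    by_cases h : w = u
    · subst h; exact tle_refl T w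
    · exact tle_trans T (tle_parent T w) (ih _ (hS w hw h).1 (by rw [← hn, Function.iterate_succ_apply]))

theorem branch_between {V : Type} (T : BurlingTree V) {u : V} {S : Set V}
    (hS : ∀ w ∈ S, w ≠ u → T.parent w ∈ S ∧ T.parent w ≠ w) {w z : V} (hw : w ∈ S)
    (hwz : tle T w z) (hzu : tle T z u) : z ∈ S := by
  obtain ⟨n, hn⟩ := hwz
  induction n generalizing w with
  | zero => exact hn ▸ hw
  | succ n ih =>
    by_cases h : w = u
    · subst h
      have : w = z := tle_antisymm T ⟨n + 1, hn⟩ hzu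
      exact this ▸ hw
    · exact ih (hS w hw h).1 (by rw [← hn, Function.iterate_succ_apply])

theorem branch_chain {V : Type} (T : BurlingTree V) {u : V} {S : Set V} (hu : T.parent u ≠ u)
    (hS : ∀ w ∈ S, w ≠ u → T.parent w ∈ S ∧ T.parent w ≠ w)
    (hI : ∀ w ∈ S, ∀ w' ∈ S, w ≠ u → w' ≠ u → T.parent w = T.parent w' → w = w')
    {w w' : V} (hw : w ∈ S) (hw' : w' ∈ S) : tle T w w' ∨ tle T w' w := by
  obtain ⟨n, hn⟩ := branch_le T hS w hw
  induction n generalizing w with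
  | zero =>
    right
    have : w = u := hn
    rw [this]; exact branch_le T hS w' hw'
  | succ n ih =>
    by_cases h : w = u
    · right; rw [h]; exact branch_le T hS w' hw'
    · have hp := hS w hw h
      rcases ih hp.1 (by rw [← hn, Function.iterate_succ_apply]) with h1 | h1
      · left; exact tle_trans T (tle_parent T w) h1
      · obtain ⟨k, hk⟩ := h1
        cases k with
        | zero =>
          left
          have : w' = T.parent w := hk
          rw [this]; exact tle_parent T w
        | succ k =>
          right
          refine ⟨k, ?_⟩
          have hpu : tle T (T.parent w) u := branch_le T hS _ hp.1
          rw [Function.iterate_succ_apply'] at hk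
          have hz : T.parent^[k] w' ∈ S := by
            refine branch_between T hS hw' ⟨k, rfl⟩ (tle_trans T (y := T.parent w) ⟨1, hk⟩ hpu)
          by_cases hzu : T.parent^[k] w' = u
          · -- then everything collapses
            exfalso
            rw [hzu] at hk
            have h2 : tle T u (T.parent w) := ⟨1, hk⟩
            exact hu (hk.trans (tle_antisymm T hpu h2))
          · exact hI _ hz _ hw hzu h hk

/-- All that is known about an arc. -/
theorem arc_spec {V : Type} (T : BurlingTree V) {u v : V} (h : T.Arc u v) :
    ∃ l, T.parent l = T.parent u ∧ l = T.lastBorn (T.parent u) ∧ l ≠ u ∧ T.parent l ≠ l ∧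
      T.parent u ≠ u ∧ tle T v l ∧
      (∀ z, tle T v z → tle T z l → T.Arc u z) ∧
      (∀ z, T.Arc u z → tle T v z ∨ tle T z v) := by
  have h1 : u ≠ T.root := by
    intro h0
    have := T.choosePath_empty u (Or.inl h0)
    simp [BurlingTree.Arc, this] at h
  have h2 : u ≠ T.lastBorn (T.parent u) := by
    intro h0
    have := T.choosePath_empty u (Or.inr h0)
    simp [BurlingTree.Arc, this] at h
  have hpu : T.parent u ≠ u := fun h0 => h1 (periodic_root T (k := 1) (by omega) h0)
  have h3 := T.lastBorn_child (T.parent u) ⟨u, hpu.symm, rfl⟩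
  rcases T.choosePath_branch u h1 h2 with hb | ⟨hb1, hb2, hb3⟩
  · simp [BurlingTree.Arc, hb] at h
  · have hpl : T.parent (T.lastBorn (T.parent u)) ≠ T.lastBorn (T.parent u) := by
      rw [h3.1]; exact h3.2.symm
    refine ⟨T.lastBorn (T.parent u), h3.1, rfl, h2.symm, hpl, hpu, branch_le T hb2 v h, ?_, ?_⟩
    · intro z hz hz'
      exact branch_between T hb2 h hz hz'
    · intro z hz
      exact branch_chain T hpl hb2 hb3 h hz

theorem arc_B1 {V : Type} (T : BurlingTree V) {u v w : V} (h : T.Arc u v) (h' : T.Arc u w)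
    (hne : v ≠ w) : tlt T v w ∨ tlt T w v := by
  obtain ⟨l, -, -, -, -, -, -, -, hl⟩ := arc_spec T h
  rcases hl w h' with h1 | h1
  · exact Or.inl ⟨h1, hne⟩
  · exact Or.inr ⟨h1, hne.symm⟩

theorem arc_B2 {V : Type} (T : BurlingTree V) {x v y : V} (h : tlt T x v) (h' : T.Arc x y) :
    tlt T y v := by
  obtain ⟨l, hl1, -, -, hl2, -, hl3, -, -⟩ := arc_spec T h'
  have h1 : tle T (T.parent x) v := tle_step T h.1 h.2
  have h2 : tle T l (T.parent x) := ⟨1, hl1⟩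
  refine ⟨tle_trans T hl3 (tle_trans T h2 h1), ?_⟩
  rintro rfl
  have := tle_antisymm T h2 (tle_trans T h1 hl3)
  exact hl2 (hl1.trans this.symm)

theorem arc_B3 {V : Type} (T : BurlingTree V) {x v y : V} (h : tlt T x v) (h' : T.Arc y x) :
    tlt T y v ∨ T.Arc y v := by
  obtain ⟨l, hl1, -, -, hl2, hl4, hl3, hl5, -⟩ := arc_spec T h'
  rcases tle_linear T h.1 hl3 with h1 | h1
  · exact Or.inr (hl5 v h.1 h1)
  · by_cases hlv : l = v
    · exact Or.inr (hl5 v h.1 (hlv ▸ tle_refl T l))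
    · left
      have h2 : tle T (T.parent y) v := hl1 ▸ tle_step T h1 hlv
      refine ⟨tle_trans T (tle_parent T y) h2, ?_⟩
      rintro rfl
      exact hl4 (tle_antisymm T h2 (tle_parent T y))

theorem arc_two {V : Type} (T : BurlingTree V) {u v w : V} (h : T.Arc u v) (h' : T.Arc v w) :
    tlt T (T.parent v) (T.parent u) := by
  obtain ⟨l, hl1, hl0, -, hl2, -, hl3, -, -⟩ := arc_spec T h
  obtain ⟨l', hl1', hl0', hl6, -⟩ := arc_spec T h'
  have hvl : v ≠ l := by
    rintro rfl
    rw [hl1, ← hl0] at hl0'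
    exact hl6 hl0'
  have h1 : tle T (T.parent v) l := tle_step T hl3 hvl
  have h2 : tle T l (T.parent u) := ⟨1, hl1⟩
  refine ⟨tle_trans T h1 h2, ?_⟩
  intro h3
  rw [h3] at h1
  exact hl2 (hl1.trans (tle_antisymm T h1 h2))

theorem arc_acyclic {V : Type} (T : BurlingTree V) (u : V) : ¬ Relation.TransGen T.Arc u u := by
  have key : ∀ a b, Relation.TransGen T.Arc a b → ∀ c, T.Arc b c →
      tlt T (T.parent b) (T.parent a) := by
    intro a b h
    induction h with
    | single h => intro c hc; exact arc_two T h hc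
    | tail h1 h2 ih =>
      intro c hc
      exact tlt_trans T (arc_two T h2 hc) (ih _ h2)
  intro h
  obtain ⟨c, hc, -⟩ := Relation.TransGen.head'_iff.1 h
  exact (key u u h c hc).2 rfl

/-! ### Abstract combinatorial side -/

structure K5S {W : Type} (G : SimpleGraph W) where
  br : Fin 5 → W
  n : Fin 5 → Fin 5 → ℕ
  q : Fin 5 → Fin 5 → ℕ → W
  br_inj : ∀ i j, br i = br j → i = j
  n_symm : ∀ i j, n i j = n j i
  n_pos : ∀ i j, i ≠ j → 0 < n i j
  q_symm : ∀ i j t, i ≠ j → t ≤ n i j → q j i t = q i j (n i j - t)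
  q_zero : ∀ i j, i ≠ j → q i j 0 = br i
  q_inj : ∀ i j s t, i ≠ j → s ≤ n i j → t ≤ n i j → q i j s = q i j t → s = t
  q_disj : ∀ i j k l s t, i ≠ j → k ≠ l → s ≤ n i j → t ≤ n k l → q i j s = q k l t →
    (k = i ∧ l = j) ∨ (k = j ∧ l = i) ∨ ∃ x, q i j s = br x
  q_br : ∀ i j s x, i ≠ j → s ≤ n i j → q i j s = br x → x = i ∨ x = j
  adj : ∀ x y, G.Adj x y ↔ ∃ i j s, i ≠ j ∧ s < n i j ∧ x = q i j s ∧ y = q i j (s + 1)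
  cover : ∀ w, ∃ i j t, i ≠ j ∧ t ≤ n i j ∧ w = q i j t

structure BurlA {W : Type} (G : SimpleGraph W) (A lt : W → W → Prop) : Prop where
  adj : ∀ x y, G.Adj x y ↔ A x y ∨ A y x
  B1 : ∀ u v w, A u v → A u w → v ≠ w → lt v w ∨ lt w v
  B2 : ∀ x v y, lt x v → A x y → lt y v
  B3 : ∀ x v y, lt x v → A y x → lt y v ∨ A y v
  acyc : ∀ u, ¬ Relation.TransGen A u u
  trans : ∀ x y z, lt x y → lt y z → lt x z
  irr : ∀ x, ¬ lt x x

namespace K5S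

variable {W : Type} {G : SimpleGraph W} (K : K5S G)

theorem q_n {i j : Fin 5} (h : i ≠ j) : K.q i j (K.n i j) = K.br j := by
  have := K.q_symm i j 0 h (Nat.zero_le _)
  rw [K.q_zero j i h.symm] at this
  simpa using this.symm

theorem q_rev {i j : Fin 5} {t : ℕ} (h : i ≠ j) (ht : t ≤ K.n i j) :
    K.q i j t = K.q j i (K.n i j - t) := by
  have := K.q_symm j i t h.symm (by rw [K.n_symm]; exact ht)
  rw [this, K.n_symm]

/-- interior vertices are not branch vertices -/
theorem int_ne {i j : Fin 5} {t : ℕ} (h : i ≠ j) (h0 : 0 < t) (ht : t < K.n i j) (x : Fin 5) :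
    K.q i j t ≠ K.br x := by
  intro hx
  rcases K.q_br i j t x h ht.le hx with rfl | rfl
  · rw [← K.q_zero x j h] at hx
    have := K.q_inj _ _ _ _ h ht.le (Nat.zero_le _) hx
    omega
  · rw [← K.q_n h] at hx
    have := K.q_inj _ _ _ _ h ht.le le_rfl hx
    omega

theorem end_of_br {i j : Fin 5} {t : ℕ} (h : i ≠ j) (ht : t ≤ K.n i j) {x : Fin 5}
    (hx : K.q i j t = K.br x) : (t = 0 ∧ x = i) ∨ (t = K.n i j ∧ x = j) := by
  rcases Nat.eq_zero_or_pos t with h0 | h0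
  · left
    subst h0
    rw [K.q_zero i j h] at hx
    exact ⟨rfl, (K.br_inj _ _ hx).symm⟩
  · rcases Nat.lt_or_ge t (K.n i j) with h1 | h1
    · exact absurd hx (K.int_ne h h0 h1 x)
    · right
      have : t = K.n i j := by omega
      subst this
      rw [K.q_n h] at hx
      exact ⟨rfl, (K.br_inj _ _ hx).symm⟩

/-- an interior vertex determines its path -/
theorem int_label {i j k l : Fin 5} {s t : ℕ} (h : i ≠ j) (h' : k ≠ l) (h0 : 0 < s)
    (hs : s < K.n i j) (ht : t ≤ K.n k l) (e : K.q i j s = K.q k l t) :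
    (k = i ∧ l = j ∧ t = s) ∨ (k = j ∧ l = i ∧ t = K.n i j - s) := by
  rcases K.q_disj i j k l s t h h' hs.le ht e with ⟨rfl, rfl⟩ | ⟨rfl, rfl⟩ | ⟨x, hx⟩
  · left; exact ⟨rfl, rfl, (K.q_inj _ _ _ _ h hs.le ht e).symm⟩
  · right
    refine ⟨rfl, rfl, ?_⟩
    rw [K.q_rev h hs.le] at e
    exact (K.q_inj _ _ _ _ h.symm (by rw [K.n_symm]; omega) ht e).symm
  · exact absurd hx (K.int_ne h h0 hs x)

theorem nbr_br {i : Fin 5} {y : W} (h : G.Adj (K.br i) y) : ∃ j, i ≠ j ∧ y = K.q i j 1 := by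
  obtain ⟨k, l, s, hkl, hs, h1, h2⟩ := (K.adj _ _).1 h
  rcases K.end_of_br hkl hs.le h1.symm with ⟨rfl, rfl⟩ | ⟨h3, -⟩
  · exact ⟨l, hkl, h2⟩
  · omega

theorem nbr_int {i j : Fin 5} {t : ℕ} (h : i ≠ j) (h0 : 0 < t) (ht : t < K.n i j) {y : W}
    (ha : G.Adj (K.q i j t) y) : y = K.q i j (t - 1) ∨ y = K.q i j (t + 1) := by
  obtain ⟨k, l, s, hkl, hs, h1, h2⟩ := (K.adj _ _).1 ha
  rcases K.int_label h hkl h0 ht hs.le h1 with ⟨rfl, rfl, rfl⟩ | ⟨rfl, rfl, h3⟩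
  · exact Or.inr h2
  · left
    rw [h2, K.q_rev hkl (by omega)]
    congr 1
    have hn := K.n_symm k l
    omega

theorem adj_succ {i j : Fin 5} {t : ℕ} (h : i ≠ j) (ht : t < K.n i j) :
    G.Adj (K.q i j t) (K.q i j (t + 1)) :=
  (K.adj _ _).2 ⟨i, j, t, h, ht, rfl, rfl⟩

theorem one_inj {i j k : Fin 5} (h : i ≠ j) (h' : i ≠ k) {r : ℕ} (hr : r ≤ K.n i k)
    (e : K.q i j 1 = K.q i k r) : k = j ∧ r = 1 := by
  have h1 := K.n_pos i j h
  rcases K.q_disj i j i k 1 r h h' h1 hr e with ⟨-, rfl⟩ | ⟨h2, -⟩ | ⟨x, hx⟩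
  · exact ⟨rfl, (K.q_inj _ _ _ _ h h1 hr e).symm⟩
  · exact absurd h2 h
  · rcases K.end_of_br h h1 hx with ⟨h2, -⟩ | ⟨-, rfl⟩
    · omega
    · rw [e] at hx
      rcases K.end_of_br h' hr hx with ⟨-, h2⟩ | ⟨h2, rfl⟩
      · exact absurd h2 h.symm
      · exact ⟨rfl, K.q_inj _ _ _ _ h hr h1 e.symm⟩

theorem nbr_pos {l m : Fin 5} {r : ℕ} (h : l ≠ m) (hr : r ≤ K.n l m)
    (ha : G.Adj (K.br l) (K.q l m r)) : r = 1 := by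
  obtain ⟨j, hj, e⟩ := K.nbr_br ha
  exact (K.one_inj hj h hr e.symm).2

theorem nbr_lab {l k m : Fin 5} {r : ℕ} (h : k ≠ m) (h0 : 0 < r) (hr : r < K.n k m)
    (ha : G.Adj (K.br l) (K.q k m r)) : l = k ∨ l = m := by
  obtain ⟨j, hj, e⟩ := K.nbr_br ha
  rcases K.int_label h hj h0 hr (K.n_pos l j hj) e with ⟨h1, -⟩ | ⟨h1, -⟩
  · exact Or.inl h1
  · exact Or.inr h1

theorem cases_vertex (w : W) : (∃ i, w = K.br i) ∨
    ∃ i j t, i ≠ j ∧ 0 < t ∧ t < K.n i j ∧ w = K.q i j t := by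
  obtain ⟨i, j, t, h, ht, e⟩ := K.cover w
  rcases Nat.eq_zero_or_pos t with h0 | h0
  · subst h0; rw [K.q_zero i j h] at e; exact Or.inl ⟨i, e⟩
  · rcases Nat.lt_or_ge t (K.n i j) with h1 | h1
    · exact Or.inr ⟨i, j, t, h, h0, h1, e⟩
    · have : t = K.n i j := by omega
      subst this
      rw [K.q_n h] at e; exact Or.inl ⟨j, e⟩

theorem finite (K : K5S G) : Finite W := by
  let f : (Σ i : Fin 5, Σ j : Fin 5, Fin (K.n i j + 1)) → W := fun a => K.q a.1 a.2.1 a.2.2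
  refine Finite.of_surjective f ?_
  intro w
  obtain ⟨i, j, t, h, ht, e⟩ := K.cover w
  exact ⟨⟨i, j, ⟨t, by omega⟩⟩, e.symm⟩

end K5S

namespace BurlA

variable {W : Type} {G : SimpleGraph W} {A lt : W → W → Prop} (H : BurlA G A lt)

theorem bdry (H : BurlA G A lt) {x y v : W} (hx : lt x v) (h : G.Adj x y) : lt y v ∨ A y v := by
  rcases (H.adj _ _).1 h with h | h
  · exact Or.inl (H.B2 _ _ _ hx h)
  · exact H.B3 _ _ _ hx h

theorem irrA (H : BurlA G A lt) (u : W) : ¬ A u u := fun h => H.acyc u (.single h)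

theorem nlt (H : BurlA G A lt) {u v : W} (h : A u v) : ¬ lt u v :=
  fun h' => H.irr _ (H.B2 _ _ _ h' h)

theorem nlt' (H : BurlA G A lt) {u v : W} (h : A u v) : ¬ lt v u := fun h' => by
  rcases H.B3 _ _ _ h' h with h1 | h1
  · exact H.irr _ h1
  · exact H.irrA _ h1

theorem asymm (H : BurlA G A lt) {u v : W} (h : A u v) : ¬ A v u := fun h' =>
  H.acyc u (.tail (.single h) h')

theorem adjA (H : BurlA G A lt) {u v : W} (h : A u v) : G.Adj u v := (H.adj _ _).2 (Or.inl h)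

theorem adjA' (H : BurlA G A lt) {u v : W} (h : A u v) : G.Adj v u := (H.adj _ _).2 (Or.inr h)

/-- a last element of a nonempty set -/
theorem exists_last [Finite W] (H : BurlA G A lt) (Y : Set W) (hY : Y.Nonempty) :
    ∃ y ∈ Y, ∀ y', A y y' → y' ∉ Y := by
  let r : W → W → Prop := fun a b => Relation.TransGen A b a
  have : IsTrans W r := ⟨fun a b c h1 h2 => Relation.TransGen.trans h2 h1⟩
  have : Std.Irrefl r := ⟨fun a h => H.acyc a h⟩
  have wf : WellFounded r := Finite.wellFounded_of_trans_of_irrefl r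
  obtain ⟨y, hy, hm⟩ := wf.has_min Y hY
  exact ⟨y, hy, fun y' h h' => hm y' h' (.single h)⟩

theorem cross (H : BurlA G A lt) (K : K5S G) {i j : Fin 5} (h : i ≠ j) {v : W} {s t : ℕ}
    (hst : s ≤ t) (ht : t ≤ K.n i j) (h1 : lt (K.q i j s) v) (h2 : ¬ lt (K.q i j t) v) :
    ∃ r, s < r ∧ r ≤ t ∧ A (K.q i j r) v := by
  induction t with
  | zero =>
    have : s = 0 := by omega
    subst this; exact absurd h1 h2
  | succ t ih =>
    by_cases hs : s = t + 1
    · subst hs; exact absurd h1 h2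
    · by_cases h3 : lt (K.q i j t) v
      · rcases H.bdry h3 (K.adj_succ h (by omega)) with h4 | h4
        · exact absurd h4 h2
        · exact ⟨t + 1, by omega, le_rfl, h4⟩
      · obtain ⟨r, hr1, hr2, hr3⟩ := ih (by omega) (by omega) h3
        exact ⟨r, hr1, by omega, hr3⟩

theorem cross' (H : BurlA G A lt) (K : K5S G) {i j : Fin 5} (h : i ≠ j) {v : W} {s t : ℕ}
    (hst : t ≤ s) (hs : s ≤ K.n i j) (h1 : lt (K.q i j s) v) (h2 : ¬ lt (K.q i j t) v) :
    ∃ r, t ≤ r ∧ r < s ∧ A (K.q i j r) v := by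
  rw [K.q_rev h hs] at h1
  rw [K.q_rev h (hst.trans hs)] at h2
  obtain ⟨r, h3, h4, h5⟩ := H.cross K h.symm (s := K.n i j - s) (t := K.n i j - t) (by omega)
    (by rw [K.n_symm]; omega) h1 h2
  refine ⟨K.n i j - r, by omega, by omega, ?_⟩
  rw [K.q_rev h (by omega)]
  rwa [show K.n i j - (K.n i j - r) = r by omega]

/-- `v` is full: some branch vertex lies below it. -/
def Full (K : K5S G) (lt : W → W → Prop) (v : W) : Prop := ∃ i, lt (K.br i) v

theorem full_br1 (H : BurlA G A lt) (K : K5S G) {l a y : Fin 5} (ha : lt (K.br a) (K.br l))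
    (hy : y ≠ l) : lt (K.br y) (K.br l) ∨ A (K.br y) (K.br l) := by
  by_contra hcon
  push Not at hcon
  have hay : a ≠ y := by rintro rfl; exact hcon.1 ha
  have hal : a ≠ l := by rintro rfl; exact H.irr _ ha
  obtain ⟨r, h1, h2, h3⟩ := H.cross K hay (v := K.br l) (s := 0) (t := K.n a y) (Nat.zero_le _) le_rfl
    (by rw [K.q_zero _ _ hay]; exact ha) (by rw [K.q_n hay]; exact hcon.1)
  have h4 : r ≠ K.n a y := by
    rintro rfl
    rw [K.q_n hay] at h3; exact hcon.2 h3
  rcases K.nbr_lab hay h1 (by omega) (H.adjA' h3) with h5 | h5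
  · exact hal h5.symm
  · exact hy h5.symm

theorem full_br2 (H : BurlA G A lt) (K : K5S G) {l : Fin 5} (hf : Full K lt (K.br l)) {y : W}
    (hy : G.Adj (K.br l) y) : A y (K.br l) := by
  obtain ⟨a, ha⟩ := hf
  obtain ⟨j, hj, rfl⟩ := K.nbr_br hy
  rcases H.full_br1 K ha hj.symm with h | h
  · obtain ⟨r, h1, h2, h3⟩ := H.cross K hj.symm (v := K.br l) (s := 0) (t := K.n j l)
      (Nat.zero_le _) le_rfl (by rw [K.q_zero _ _ hj.symm]; exact h)
      (by rw [K.q_n hj.symm]; exact H.irr _)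
    rw [K.q_rev hj.symm h2] at h3
    have := K.nbr_pos hj (by rw [K.n_symm]; omega) (H.adjA' h3)
    rwa [this] at h3
  · have h2 := H.adjA' h
    rw [← K.q_n hj] at h2 h
    have := K.nbr_pos hj le_rfl h2
    rwa [this] at h

/-- two in-neighbours of an interior vertex enclose only that vertex -/
theorem enclose (H : BurlA G A lt) (K : K5S G) {i j k l : Fin 5} {t r1 s r2 : ℕ} (h : i ≠ j)
    (h0 : 0 < t) (ht : t < K.n i j) (hkl : k ≠ l) (h1 : r1 < s) (h2 : s < r2) (h3 : r2 ≤ K.n k l)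
    (a1 : A (K.q k l r1) (K.q i j t)) (a2 : A (K.q k l r2) (K.q i j t)) :
    K.q k l s = K.q i j t := by
  obtain ⟨k', l', s', hk, hs, e1, e2⟩ := (K.adj _ _).1 (H.adjA' a1)
  have e1' := K.nbr_int h h0 ht (H.adjA' a1)
  have e2' := K.nbr_int h h0 ht (H.adjA' a2)
  clear e1 e2 hk hs
  -- the vertex labels
  have hlab : (k = i ∧ l = j) ∨ (k = j ∧ l = i) := by
    by_contra hcon
    have br1 : ∃ x, K.q k l r1 = K.br x := by
      rcases e1' with e | e
      · rcases K.q_disj k l i j r1 (t - 1) hkl h (by omega) (by omega) e with ⟨h5, h6⟩ | ⟨h5, h6⟩ | h5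
        · exact absurd (Or.inl ⟨h5.symm, h6.symm⟩) hcon
        · exact absurd (Or.inr ⟨h6.symm, h5.symm⟩) hcon
        · exact h5
      · rcases K.q_disj k l i j r1 (t + 1) hkl h (by omega) (by omega) e with ⟨h5, h6⟩ | ⟨h5, h6⟩ | h5
        · exact absurd (Or.inl ⟨h5.symm, h6.symm⟩) hcon
        · exact absurd (Or.inr ⟨h6.symm, h5.symm⟩) hcon
        · exact h5
    have br2 : ∃ x, K.q k l r2 = K.br x := by
      rcases e2' with e | e
      · rcases K.q_disj k l i j r2 (t - 1) hkl h (by omega) (by omega) e with ⟨h5, h6⟩ | ⟨h5, h6⟩ | h5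
        · exact absurd (Or.inl ⟨h5.symm, h6.symm⟩) hcon
        · exact absurd (Or.inr ⟨h6.symm, h5.symm⟩) hcon
        · exact h5
      · rcases K.q_disj k l i j r2 (t + 1) hkl h (by omega) (by omega) e with ⟨h5, h6⟩ | ⟨h5, h6⟩ | h5
        · exact absurd (Or.inl ⟨h5.symm, h6.symm⟩) hcon
        · exact absurd (Or.inr ⟨h6.symm, h5.symm⟩) hcon
        · exact h5
    obtain ⟨x, hx⟩ := br1
    obtain ⟨y, hy⟩ := br2
    have hx1 : x = k := by
      rcases K.end_of_br hkl (by omega) hx with h5 | h5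
      · exact h5.2
      · omega
    have hy1 : y = l := by
      rcases K.end_of_br hkl (by omega) hy with h5 | h5
      · omega
      · exact h5.2
    have hx2 : x = i ∨ x = j := by
      rcases e1' with e | e <;> rw [hx] at e <;> exact K.q_br _ _ _ _ h (by omega) e.symm
    have hy2 : y = i ∨ y = j := by
      rcases e2' with e | e <;> rw [hy] at e <;> exact K.q_br _ _ _ _ h (by omega) e.symm
    subst hx1 hy1
    rcases hx2 with rfl | rfl <;> rcases hy2 with rfl | rfl <;> simp_all
  rcases hlab with ⟨rfl, rfl⟩ | ⟨rfl, rfl⟩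
  · have f1 : r1 = t - 1 ∨ r1 = t + 1 := by
      rcases e1' with e | e
      · exact Or.inl (K.q_inj _ _ _ _ h (by omega) (by omega) e)
      · exact Or.inr (K.q_inj _ _ _ _ h (by omega) (by omega) e)
    have f2 : r2 = t - 1 ∨ r2 = t + 1 := by
      rcases e2' with e | e
      · exact Or.inl (K.q_inj _ _ _ _ h (by omega) (by omega) e)
      · exact Or.inr (K.q_inj _ _ _ _ h (by omega) (by omega) e)
    congr 1; omega
  · have hn := K.n_symm k l
    have f1 : K.n k l - r1 = t - 1 ∨ K.n k l - r1 = t + 1 := by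
      rw [K.q_rev hkl (by omega)] at e1'
      rcases e1' with e | e
      · exact Or.inl (K.q_inj _ _ _ _ h (by omega) (by omega) e)
      · exact Or.inr (K.q_inj _ _ _ _ h (by omega) (by omega) e)
    have f2 : K.n k l - r2 = t - 1 ∨ K.n k l - r2 = t + 1 := by
      rw [K.q_rev hkl (by omega)] at e2'
      rcases e2' with e | e
      · exact Or.inl (K.q_inj _ _ _ _ h (by omega) (by omega) e)
      · exact Or.inr (K.q_inj _ _ _ _ h (by omega) (by omega) e)
    rw [K.q_rev hkl (by omega)]
    congr 1; omega

/-- an interior vertex with something below it is full -/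
theorem int_full (H : BurlA G A lt) (K : K5S G) {i j : Fin 5} {t : ℕ} (h : i ≠ j)
    (h0 : 0 < t) (ht : t < K.n i j) {x : W} (hx : lt x (K.q i j t)) : Full K lt (K.q i j t) := by
  by_contra hf
  obtain ⟨k, l, s, hkl, hs, rfl⟩ := K.cover x
  obtain ⟨r2, h1, h2, h3⟩ := H.cross K hkl hs le_rfl hx
    (by rw [K.q_n hkl]; exact fun h => hf ⟨_, h⟩)
  obtain ⟨r1, h4, h5, h6⟩ := H.cross' K hkl (Nat.zero_le s) hs hx
    (by rw [K.q_zero _ _ hkl]; exact fun h => hf ⟨_, h⟩)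
  have := H.enclose K h h0 ht hkl h5 h1 h2 h6 h3
  rw [this] at hx
  exact H.irr _ hx

theorem full_int1 (H : BurlA G A lt) (K : K5S G) {i j : Fin 5} {t : ℕ} (h : i ≠ j)
    (h0 : 0 < t) (ht : t < K.n i j) (hf : Full K lt (K.q i j t)) (y : Fin 5) :
    lt (K.br y) (K.q i j t) ∨ A (K.br y) (K.q i j t) := by
  obtain ⟨a, ha⟩ := hf
  have key : ∀ a y, lt (K.br a) (K.q i j t) → ¬ lt (K.br y) (K.q i j t) →
      ¬ A (K.br y) (K.q i j t) → (a = i ∨ a = j) ∧ (y = i ∨ y = j) := by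
    intro a y ha h1 h2
    have hay : a ≠ y := by rintro rfl; exact h1 ha
    obtain ⟨r, h3, h4, h5⟩ := H.cross K hay (v := K.q i j t) (s := 0) (t := K.n a y)
      (Nat.zero_le _) le_rfl
      (by rw [K.q_zero _ _ hay]; exact ha) (by rw [K.q_n hay]; exact h1)
    have h6 : r ≠ K.n a y := by
      rintro rfl
      rw [K.q_n hay] at h5; exact h2 h5
    rcases K.nbr_int h h0 ht (H.adjA' h5) with e | e
    · rcases K.int_label hay h h3 (by omega) (by omega) e with ⟨rfl, rfl, -⟩ | ⟨rfl, rfl, -⟩ <;> simp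
    · rcases K.int_label hay h h3 (by omega) (by omega) e with ⟨rfl, rfl, -⟩ | ⟨rfl, rfl, -⟩ <;> simp
  by_contra hcon
  push Not at hcon
  obtain ⟨c, hc1, hc2⟩ : ∃ c : Fin 5, c ≠ i ∧ c ≠ j := by
    clear * -
    revert i j; decide
  have hc : lt (K.br c) (K.q i j t) := by
    by_contra h1
    have h2 : ¬ A (K.br c) (K.q i j t) := by
      intro h2
      rcases K.nbr_int h h0 ht (H.adjA' h2) with e | e
      · rcases K.q_br _ _ _ _ h (by omega) e.symm with h3 | h3
        · exact hc1 h3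
        · exact hc2 h3
      · rcases K.q_br _ _ _ _ h (by omega) e.symm with h3 | h3
        · exact hc1 h3
        · exact hc2 h3
    rcases (key a c ha h1 h2).2 with h3 | h3
    · exact hc1 h3
    · exact hc2 h3
  rcases (key c y hc hcon.1 hcon.2).1 with h3 | h3
  · exact hc1 h3
  · exact hc2 h3

theorem full_int2 (H : BurlA G A lt) (K : K5S G) {i j : Fin 5} {t : ℕ} (h : i ≠ j)
    (h0 : 0 < t) (ht : t < K.n i j) (hf : Full K lt (K.q i j t)) (z : W) :
    z = K.q i j t ∨ lt z (K.q i j t) ∨ A z (K.q i j t) := by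
  by_contra hcon
  push Not at hcon
  obtain ⟨c1, c2, c3⟩ := hcon
  obtain ⟨k, l, s, hkl, hs, rfl⟩ := K.cover z
  have H1 : ∃ r1, r1 < s ∧ A (K.q k l r1) (K.q i j t) := by
    have hne : ∀ r, A (K.q k l r) (K.q i j t) → r ≠ s := by
      rintro r hr rfl; exact c3 hr
    rcases H.full_int1 K h h0 ht hf k with h1 | h1
    · rw [← K.q_zero k l hkl] at h1
      obtain ⟨r, h2, h3, h4⟩ := H.cross K hkl (Nat.zero_le s) hs h1 c2
      have := hne r h4
      exact ⟨r, by omega, h4⟩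
    · rw [← K.q_zero k l hkl] at h1
      have := hne 0 h1
      exact ⟨0, by omega, h1⟩
  have H2 : ∃ r2, s < r2 ∧ r2 ≤ K.n k l ∧ A (K.q k l r2) (K.q i j t) := by
    have hne : ∀ r, A (K.q k l r) (K.q i j t) → r ≠ s := by
      rintro r hr rfl; exact c3 hr
    rcases H.full_int1 K h h0 ht hf l with h1 | h1
    · rw [← K.q_n hkl] at h1
      obtain ⟨r, h2, h3, h4⟩ := H.cross' K hkl hs le_rfl h1 c2
      have := hne r h4
      exact ⟨r, by omega, by omega, h4⟩
    · rw [← K.q_n hkl] at h1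
      have := hne _ h1
      exact ⟨_, by omega, le_rfl, h1⟩
  obtain ⟨r1, h1, h2⟩ := H1
  obtain ⟨r2, h3, h4, h5⟩ := H2
  exact c1 (H.enclose K h h0 ht hkl h1 h3 h4 h2 h5)

/-- every neighbour of a full vertex is an in-neighbour -/
theorem full_in (H : BurlA G A lt) (K : K5S G) {v : W} (hf : Full K lt v) {y : W}
    (hy : G.Adj v y) : A y v := by
  rcases K.cases_vertex v with ⟨l, rfl⟩ | ⟨i, j, t, h, h0, ht, rfl⟩
  · exact H.full_br2 K hf hy
  · rcases H.full_int2 K h h0 ht hf y with rfl | h1 | h1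
    · exact absurd hy (G.loopless.irrefl _)
    · rcases (H.adj _ _).1 hy with h2 | h2
      · exact absurd h1 (H.nlt' h2)
      · exact h2
    · exact h1

theorem full_sink (H : BurlA G A lt) (K : K5S G) {v : W} (hf : Full K lt v) (y : W) : ¬ A v y :=
  fun h => H.asymm h (H.full_in K hf (H.adjA h))

/-- The vertices of the third type. -/
def IsB (K : K5S G) (lt : W → W → Prop) (w : W) : Prop := (∃ l, w = K.br l) ∧ ¬ Full K lt w

theorem tri (H : BurlA G A lt) (K : K5S G) {x v : W} (hx : lt x v) : Full K lt v ∨ IsB K lt v := by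
  by_cases hf : Full K lt v
  · exact Or.inl hf
  · right
    rcases K.cases_vertex v with hl | ⟨i, j, t, h, h0, ht, rfl⟩
    · exact ⟨hl, hf⟩
    · exact absurd (H.int_full K h h0 ht hx) hf

/-- structure of neighbours of things below type-B vertices -/
theorem B_nbr (H : BurlA G A lt) (K : K5S G) {w u x : W} (hw : IsB K lt w) (hu : A u w)
    (hux : A u x) (hx : lt x w) : ∃ m k, m ≠ k ∧ u = K.br m ∧ 1 < K.n m k ∧ x = K.q m k 1 := by
  obtain ⟨⟨l, rfl⟩, hf⟩ := hw
  have main : ∀ k m s, k ≠ m → 0 < s → s < K.n k m → x = K.q k m s → u = K.q k m (s + 1) →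
      s + 1 = K.n k m := by
    rintro k m s hkm h0 hs rfl rfl
    obtain ⟨r1, h4, h5, h6⟩ := H.cross' K hkm (Nat.zero_le s) hs.le hx
      (by rw [K.q_zero _ _ hkm]; exact fun h => hf ⟨_, h⟩)
    by_contra hcon
    rcases K.nbr_lab hkm (by omega) (by omega) (H.adjA' hu) with rfl | rfl
    · have e1 := K.nbr_pos hkm (by omega) (H.adjA' hu)
      have e2 := K.nbr_pos hkm (by omega) (H.adjA' h6)
      omega
    · rw [K.q_rev hkm (by omega)] at hu h6
      have hn := K.n_symm k l
      have e1 := K.nbr_pos hkm.symm (by omega) (H.adjA' hu)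
      have e2 := K.nbr_pos hkm.symm (by omega) (H.adjA' h6)
      omega
  have fin : ∀ k m s, k ≠ m → 0 < s → s < K.n k m → x = K.q k m s → u = K.q k m (s + 1) →
      ∃ m k, m ≠ k ∧ u = K.br m ∧ 1 < K.n m k ∧ x = K.q m k 1 := by
    intro k m s hkm h0 hs e1 e2
    have e3 := main k m s hkm h0 hs e1 e2
    have hn := K.n_symm k m
    refine ⟨m, k, hkm.symm, ?_, by omega, ?_⟩
    · rw [e2, e3, K.q_n hkm]
    · rw [e1, K.q_rev hkm hs.le]; congr 1; omega
  rcases K.cases_vertex x with ⟨a, rfl⟩ | ⟨k, m, s, hkm, h0, hs, e⟩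
  · exact absurd ⟨a, hx⟩ hf
  · have h1 : G.Adj (K.q k m s) u := by rw [← e]; exact H.adjA' hux
    rcases K.nbr_int hkm h0 hs h1 with h2 | h2
    · have hn := K.n_symm k m
      refine fin m k (K.n k m - s) hkm.symm (by omega) (by omega) ?_ ?_
      · rw [e, K.q_rev hkm hs.le]
      · rw [h2, K.q_rev hkm (by omega)]; congr 1; omega
    · exact fin k m s hkm h0 hs e h2

/-- a sink below a type-B vertex, on a prescribed path -/
theorem B_sink (H : BurlA G A lt) (K : K5S G) {w u x : W} (hw : IsB K lt w) (hu : A u w)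
    (hux : A u x) (hx : lt x w) : ∃ m k r, m ≠ k ∧ u = K.br m ∧ 0 < r ∧ r < K.n m k ∧
      lt (K.q m k r) w ∧ ∀ y, ¬ A (K.q m k r) y := by
  have := K.finite
  obtain ⟨m, k, hmk, hum, h1, h2⟩ := H.B_nbr K hw hu hux hx
  obtain ⟨y, ⟨r, hr0, hr1, rfl, hy⟩, hlast⟩ := H.exists_last
    {y | ∃ r, 0 < r ∧ r < K.n m k ∧ y = K.q m k r ∧ lt y w} ⟨x, 1, by omega, h1, h2, hx⟩
  refine ⟨m, k, r, hmk, hum, hr0, hr1, hy, ?_⟩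
  intro y hA
  apply hlast y hA
  have hyw := H.B2 _ _ _ hy hA
  rcases K.nbr_int hmk hr0 hr1 (H.adjA hA) with e | e
  · refine ⟨r - 1, ?_, by omega, e, hyw⟩
    by_contra hcon
    have : r - 1 = 0 := by omega
    rw [this, K.q_zero _ _ hmk] at e
    exact hw.2 ⟨m, e ▸ hyw⟩
  · refine ⟨r + 1, by omega, ?_, e, hyw⟩
    by_contra hcon
    have : r + 1 = K.n m k := by omega
    rw [this, K.q_n hmk] at e
    exact hw.2 ⟨k, e ▸ hyw⟩

end BurlA

namespace BurlA

variable {W : Type} {G : SimpleGraph W} {A lt : W → W → Prop}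

theorem F0_unique (H : BurlA G A lt) (K : K5S G) {v v' : W} (hf : Full K lt v)
    (hb : ¬ ∃ l, v = K.br l) (hf' : Full K lt v') (hne : v' ≠ v) : lt v' v := by
  rcases K.cases_vertex v with hl | ⟨i, j, t, h, h0, ht, rfl⟩
  · exact absurd hl hb
  · rcases H.full_int2 K h h0 ht hf v' with h1 | h1 | h1
    · exact absurd h1 hne
    · exact h1
    · exact absurd h1 (H.full_sink K hf' _)

theorem FA_unique (H : BurlA G A lt) (K : K5S G) {l l' : Fin 5} (hf : Full K lt (K.br l))
    (hf' : Full K lt (K.br l')) (hne : l' ≠ l) : lt (K.br l') (K.br l) := by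
  obtain ⟨a, ha⟩ := hf
  rcases H.full_br1 K ha hne with h1 | h1
  · exact h1
  · exact absurd h1 (H.full_sink K hf' _)

theorem ltasymm (H : BurlA G A lt) {u v : W} (h : lt u v) : ¬ lt v u :=
  fun h' => H.irr _ (H.trans _ _ _ h h')

/-- a full interior vertex is not below a type-B vertex -/
theorem F0_not_B (H : BurlA G A lt) (K : K5S G) {v w : W} (hf : Full K lt v)
    (hw : IsB K lt w) : ¬ lt v w := by
  intro hlt
  obtain ⟨a, ha⟩ := hf
  exact hw.2 ⟨a, H.trans _ _ _ ha hlt⟩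

/-- the extra sink -/
theorem extra_sink (H : BurlA G A lt) (K : K5S G) {v : W} (hf : Full K lt v) :
    ∃ e, (∀ y, ¬ A e y) ∧ lt e v ∧ ∀ w, IsB K lt w → ¬ lt e w := by
  have := K.finite
  obtain ⟨a, ha⟩ := hf
  obtain ⟨y, ⟨hy1, hy2⟩, hlast⟩ := H.exists_last
    {y | lt y v ∧ ∀ w, IsB K lt w → ¬ lt y w} ⟨K.br a, ha, fun w hw h => hw.2 ⟨a, h⟩⟩
  refine ⟨y, ?_, hy1, hy2⟩
  intro y' hA
  have h1 := hlast y' hA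
  have h2 := H.B2 _ _ _ hy1 hA
  simp only [Set.mem_setOf_eq, not_and, not_forall, not_not] at h1
  obtain ⟨w, hw, h3⟩ := h1 h2
  rcases H.B3 _ _ _ h3 hA with h4 | h4
  · exact hy2 w hw h4
  · apply hlast w h4
    refine ⟨H.B2 _ _ _ hy1 h4, ?_⟩
    intro w' hw' h5
    obtain ⟨⟨l, rfl⟩, -⟩ := hw
    exact hw'.2 ⟨l, h5⟩

open Classical in
theorem deg_br [Fintype W] (K : K5S G) (i : Fin 5) :
    (Finset.univ.filter (fun y => G.Adj (K.br i) y)).card = 4 := by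
  have : Finset.univ.filter (fun y => G.Adj (K.br i) y) =
      (Finset.univ.erase i).image (fun j => K.q i j 1) := by
    ext y
    simp only [Finset.mem_filter, Finset.mem_univ, true_and, Finset.mem_image, Finset.mem_erase,
      and_true]
    constructor
    · intro h
      obtain ⟨j, hj, e⟩ := K.nbr_br h
      exact ⟨j, hj.symm, e.symm⟩
    · rintro ⟨j, hj, rfl⟩
      have := K.adj_succ (t := 0) hj.symm (K.n_pos _ _ hj.symm)
      rwa [K.q_zero _ _ hj.symm] at this
  rw [this, Finset.card_image_of_injOn]
  · simp
  · intro j hj k hk e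
    simp only [Finset.coe_erase, Finset.coe_univ, Set.mem_diff, Set.mem_univ, true_and,
      Set.mem_singleton_iff] at hj hk
    have hj' : i ≠ j := fun h => hj h.symm
    have hk' : i ≠ k := fun h => hk h.symm
    exact (K.one_inj hj' hk' (K.n_pos _ _ hk') e).1.symm

open Classical in
theorem deg_int [Fintype W] (K : K5S G) {w : W} (hw : ¬ ∃ l, w = K.br l) :
    (Finset.univ.filter (fun y => G.Adj w y)).card = 2 := by
  rcases K.cases_vertex w with h | ⟨i, j, t, h, h0, ht, rfl⟩
  · exact absurd h hw
  have : Finset.univ.filter (fun y => G.Adj (K.q i j t) y) =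
      {K.q i j (t - 1), K.q i j (t + 1)} := by
    ext y
    simp only [Finset.mem_filter, Finset.mem_univ, true_and, Finset.mem_insert,
      Finset.mem_singleton]
    constructor
    · intro h1
      exact K.nbr_int h h0 ht h1
    · rintro (rfl | rfl)
      · have := K.adj_succ (t := t - 1) h (by omega)
        rw [show t - 1 + 1 = t by omega] at this
        exact this.symm
      · exact K.adj_succ h ht
  rw [this, Finset.card_pair]
  intro e
  have := K.q_inj _ _ _ _ h (by omega) (by omega) e
  omega

open Classical in
theorem out_bound [Fintype W] (H : BurlA G A lt) (K : K5S G) (u : W) :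
    (Finset.univ.filter (fun v => A u v)).card ≤
      (if ∀ y, ¬ A u y then 0 else 1) +
      ((Finset.univ.filter (fun v => Full K lt v ∧ ¬ ∃ l, v = K.br l)).filter
        (fun v => A u v)).card +
      ((Finset.univ.filter (fun v => Full K lt v ∧ ∃ l, v = K.br l)).filter
        (fun v => A u v)).card +
      (if ∃ w x, IsB K lt w ∧ A u w ∧ A u x ∧ lt x w then 1 else 0) := by
  by_cases hs : ∀ y, ¬ A u y
  · have : Finset.univ.filter (fun v => A u v) = ∅ := by
      ext v; simp [hs v]
    rw [this]; simp
  rw [if_neg hs]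
  push Not at hs
  -- lowest out-neighbour
  obtain ⟨m, hm, hmin⟩ : ∃ m, A u m ∧ ∀ y, A u y → ¬ lt y m := by
    have : IsTrans W lt := ⟨fun a b c => H.trans a b c⟩
    have : Std.Irrefl lt := ⟨fun a => H.irr a⟩
    obtain ⟨m, hm, h⟩ := (Finite.wellFounded_of_trans_of_irrefl lt).has_min {y | A u y} hs
    exact ⟨m, hm, fun y hy => h y hy⟩
  set Bs := Finset.univ.filter (fun w => IsB K lt w ∧ A u w ∧ lt m w) with hBs
  have hB : Bs.card ≤ if ∃ w x, IsB K lt w ∧ A u w ∧ A u x ∧ lt x w then 1 else 0 := by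
    split_ifs with hU
    · rw [Finset.card_le_one]
      intro a ha b hb
      simp only [hBs, Finset.mem_filter, Finset.mem_univ, true_and] at ha hb
      by_contra hne
      obtain ⟨⟨la, rfl⟩, hfa⟩ := ha.1
      obtain ⟨⟨lb, rfl⟩, hfb⟩ := hb.1
      rcases H.B1 _ _ _ ha.2.1 hb.2.1 hne with h | h
      · exact hfb ⟨_, h⟩
      · exact hfa ⟨_, h⟩
    · rw [Nat.le_zero, Finset.card_eq_zero]
      ext w
      simp only [hBs, Finset.mem_filter, Finset.mem_univ, true_and, Finset.notMem_empty, iff_false]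
      rintro ⟨h1, h2, h3⟩
      exact hU ⟨w, m, h1, h2, hm, h3⟩
  refine le_trans ?_ (Nat.add_le_add_left hB _)
  rw [← Finset.card_singleton m]
  refine le_trans (Finset.card_le_card ?_) (le_trans (Finset.card_union_le
    (({m} ∪ ((Finset.univ.filter (fun v => Full K lt v ∧ ¬ ∃ l, v = K.br l)).filter
        (fun v => A u v))) ∪ ((Finset.univ.filter (fun v => Full K lt v ∧ ∃ l, v = K.br l)).filter
        (fun v => A u v))) Bs) (Nat.add_le_add_right (le_trans (Finset.card_union_le _ _)
          (Nat.add_le_add_right (Finset.card_union_le _ _) _)) _))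
  intro v hv
  simp only [hBs, Finset.mem_filter, Finset.mem_univ, true_and, Finset.mem_union,
    Finset.mem_singleton] at hv ⊢
  by_cases hvm : v = m
  · simp [hvm]
  have hlt : lt m v := by
    rcases H.B1 _ _ _ hv hm hvm with h | h
    · exact absurd h (hmin v hv)
    · exact h
  rcases H.tri K hlt with h | h
  · by_cases hb : ∃ l, v = K.br l <;> simp [h, hb, hv]
  · simp [h, hv, hlt]

open Classical in
theorem main_count (H : BurlA G A lt) (K : K5S G) : False := by
  have := K.finite
  have := Fintype.ofFinite W
  set F0 := Finset.univ.filter (fun v => Full K lt v ∧ ¬ ∃ l, v = K.br l) with hF0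
  set FA := Finset.univ.filter (fun v => Full K lt v ∧ ∃ l, v = K.br l) with hFA
  set Sk := Finset.univ.filter (fun u => ∀ y, ¬ A u y) with hSk
  set U := Finset.univ.filter (fun u => ∃ w x, IsB K lt w ∧ A u w ∧ A u x ∧ lt x w) with hU
  set Br := Finset.univ.image K.br with hBr
  set N := (Finset.univ : Finset W).card with hN
  have mBr : ∀ x, x ∈ Br ↔ ∃ l, x = K.br l := by
    intro x; simp [hBr, eq_comm]
  have cBr : Br.card = 5 := by
    rw [hBr, Finset.card_image_of_injective _ (fun i j h => K.br_inj i j h)]; simp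
  -- degree sum
  have hdeg : ∑ u : W, (Finset.univ.filter (fun y => G.Adj u y)).card = 2 * N + 10 := by
    have h1 : ∀ u : W, (Finset.univ.filter (fun y => G.Adj u y)).card =
        2 + if u ∈ Br then 2 else 0 := by
      intro u
      split_ifs with h
      · obtain ⟨l, rfl⟩ := (mBr u).1 h
        exact deg_br K l
      · exact deg_int K (fun h' => h ((mBr u).2 h'))
    rw [Finset.sum_congr rfl (fun u _ => h1 u), Finset.sum_add_distrib, Finset.sum_const,
      ← Finset.sum_filter, Finset.sum_const, Finset.filter_mem_eq_inter, Finset.univ_inter, cBr,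
      ← hN]
    simp only [smul_eq_mul]; omega
  have hsplit : ∀ u : W, (Finset.univ.filter (fun y => G.Adj u y)).card =
      (Finset.univ.filter (fun y => A u y)).card + (Finset.univ.filter (fun y => A y u)).card := by
    intro u
    rw [← Finset.card_union_of_disjoint]
    · congr 1
      ext y
      simp [H.adj]
    · rw [Finset.disjoint_left]
      intro y hy hy'
      simp only [Finset.mem_filter, Finset.mem_univ, true_and] at hy hy'
      exact H.asymm hy hy'
  have hin : ∑ u : W, (Finset.univ.filter (fun y => A u y)).card =
      ∑ u : W, (Finset.univ.filter (fun y => A y u)).card :=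
    Finset.sum_card_bipartiteAbove_eq_sum_card_bipartiteBelow A
  have hout : ∑ u : W, (Finset.univ.filter (fun y => A u y)).card = N + 5 := by
    have : ∑ u : W, (Finset.univ.filter (fun y => G.Adj u y)).card =
      ∑ u : W, (Finset.univ.filter (fun y => A u y)).card +
        ∑ u : W, (Finset.univ.filter (fun y => A y u)).card := by
      rw [← Finset.sum_add_distrib]
      exact Finset.sum_congr rfl (fun u _ => hsplit u)
    omega
  have hF0s : ∑ u : W, (F0.filter (fun v => A u v)).card ≤ 2 * F0.card := by
    have h1 : ∑ u : W, (F0.filter (fun v => A u v)).card =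
        ∑ v ∈ F0, (Finset.univ.filter (fun u => A u v)).card :=
      Finset.sum_card_bipartiteAbove_eq_sum_card_bipartiteBelow A
    rw [h1, Nat.mul_comm, ← smul_eq_mul]
    apply Finset.sum_le_card_nsmul
    intro v hv
    simp only [hF0, Finset.mem_filter, Finset.mem_univ, true_and] at hv
    have := hsplit v
    rw [deg_int K hv.2] at this
    omega
  have hFAs : ∑ u : W, (FA.filter (fun v => A u v)).card ≤ 4 * FA.card := by
    have h1 : ∑ u : W, (FA.filter (fun v => A u v)).card =
        ∑ v ∈ FA, (Finset.univ.filter (fun u => A u v)).card :=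
      Finset.sum_card_bipartiteAbove_eq_sum_card_bipartiteBelow A
    rw [h1, Nat.mul_comm, ← smul_eq_mul]
    apply Finset.sum_le_card_nsmul
    intro v hv
    simp only [hFA, Finset.mem_filter, Finset.mem_univ, true_and] at hv
    obtain ⟨-, l, rfl⟩ := hv
    have := hsplit (K.br l)
    rw [deg_br K l] at this
    omega
  have hbound : N + 5 + Sk.card ≤ N + 2 * F0.card + 4 * FA.card + U.card := by
    have h1 := Finset.sum_le_sum (fun u (_ : u ∈ (Finset.univ : Finset W)) => H.out_bound K u)
    rw [hout, Finset.sum_add_distrib, Finset.sum_add_distrib, Finset.sum_add_distrib] at h1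
    simp only [← hF0, ← hFA] at h1
    have h2 : ∑ u : W, (if ∀ y, ¬ A u y then 0 else 1) + Sk.card = N := by
      rw [hSk, Finset.card_filter, ← Finset.sum_add_distrib, hN, Finset.card_eq_sum_ones]
      apply Finset.sum_congr rfl
      intro u _
      split_ifs <;> rfl
    have h3 : ∑ u : W, (if ∃ w x, IsB K lt w ∧ A u w ∧ A u x ∧ lt x w then 1 else 0) = U.card := by
      rw [hU, Finset.card_filter]
    omega
  have hF01 : F0.card ≤ 1 := by
    rw [Finset.card_le_one]
    intro a ha b hb
    simp only [hF0, Finset.mem_filter, Finset.mem_univ, true_and] at ha hb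
    by_contra hne
    exact H.ltasymm (H.F0_unique K ha.1 ha.2 hb.1 (Ne.symm hne))
      (H.F0_unique K hb.1 hb.2 ha.1 hne)
  have hFA1 : FA.card ≤ 1 := by
    rw [Finset.card_le_one]
    intro a ha b hb
    simp only [hFA, Finset.mem_filter, Finset.mem_univ, true_and] at ha hb
    obtain ⟨ha, l, rfl⟩ := ha
    obtain ⟨hb, l', rfl⟩ := hb
    by_contra hne
    have hne' : l ≠ l' := fun h => hne (by rw [h])
    exact H.ltasymm (H.FA_unique K ha hb hne'.symm) (H.FA_unique K hb ha hne')
  -- sinks attached to U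
  have hT : ∀ u ∈ U, ∃ t, (∃ m k r, m ≠ k ∧ u = K.br m ∧ 0 < r ∧ r < K.n m k ∧ t = K.q m k r) ∧
      (∃ w, IsB K lt w ∧ lt t w) ∧ ∀ y, ¬ A t y := by
    intro u hu
    simp only [hU, Finset.mem_filter, Finset.mem_univ, true_and] at hu
    obtain ⟨w, x, hw, h1, h2, h3⟩ := hu
    obtain ⟨m, k, r, h4, h5, h6, h7, h8, h9⟩ := H.B_sink K hw h1 h2 h3
    exact ⟨K.q m k r, ⟨m, k, r, h4, h5, h6, h7, rfl⟩, ⟨w, hw, h8⟩, h9⟩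
  choose! τ hτ1 hτ2 hτ3 using hT
  set T := U.image τ with hTdef
  have hUT : U.card ≤ 2 * T.card := by
    apply Finset.card_le_mul_card_image
    intro t ht
    obtain ⟨u, hu, rfl⟩ := Finset.mem_image.1 ht
    obtain ⟨m, k, r, h4, h5, h6, h7, h8⟩ := hτ1 u hu
    refine le_trans (Finset.card_le_card (t := {K.br m, K.br k}) ?_) Finset.card_le_two
    intro u' hu'
    simp only [Finset.mem_filter] at hu'
    obtain ⟨m', k', r', h4', h5', h6', h7', h8'⟩ := hτ1 u' hu'.1
    rw [hu'.2, h8] at h8'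
    simp only [Finset.mem_insert, Finset.mem_singleton]
    rcases K.int_label h4 h4' h6 h7 h7'.le h8' with ⟨rfl, -⟩ | ⟨rfl, -⟩
    · exact Or.inl h5'
    · exact Or.inr h5'
  have hUBr : U ⊆ Br := by
    intro u hu
    obtain ⟨m, k, r, h4, h5, h6, h7, h8⟩ := hτ1 u hu
    exact (mBr u).2 ⟨m, h5⟩
  have hU5 : U.card ≤ 5 := cBr ▸ Finset.card_le_card hUBr
  have hTs : T ⊆ Sk := by
    intro t ht
    obtain ⟨u, hu, rfl⟩ := Finset.mem_image.1 ht
    simp only [hSk, Finset.mem_filter, Finset.mem_univ, true_and]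
    exact hτ3 u hu
  have hTB : ∀ t ∈ T, ∃ w, IsB K lt w ∧ lt t w := by
    intro t ht
    obtain ⟨u, hu, rfl⟩ := Finset.mem_image.1 ht
    exact hτ2 u hu
  have hF0Sk : F0 ⊆ Sk := by
    intro v hv
    simp only [hF0, hSk, Finset.mem_filter, Finset.mem_univ, true_and] at hv ⊢
    exact H.full_sink K hv.1
  have hFASk : FA ⊆ Sk := by
    intro v hv
    simp only [hFA, hSk, Finset.mem_filter, Finset.mem_univ, true_and] at hv ⊢
    exact H.full_sink K hv.1
  have d1 : Disjoint T F0 := by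
    rw [Finset.disjoint_left]
    intro t ht hv
    obtain ⟨w, hw, h1⟩ := hTB t ht
    simp only [hF0, Finset.mem_filter, Finset.mem_univ, true_and] at hv
    exact H.F0_not_B K hv.1 hw h1
  have d2 : Disjoint (T ∪ F0) FA := by
    rw [Finset.disjoint_left]
    intro t ht hv
    simp only [hFA, Finset.mem_filter, Finset.mem_univ, true_and] at hv
    rcases Finset.mem_union.1 ht with ht | ht
    · obtain ⟨w, hw, h1⟩ := hTB t ht
      exact H.F0_not_B K hv.1 hw h1
    · simp only [hF0, Finset.mem_filter, Finset.mem_univ, true_and] at ht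
      exact ht.2 hv.2
  have c0 : (T ∪ F0 ∪ FA).card = T.card + F0.card + FA.card := by
    rw [Finset.card_union_of_disjoint d2, Finset.card_union_of_disjoint d1]
  have hsub : T ∪ F0 ∪ FA ⊆ Sk := Finset.union_subset (Finset.union_subset hTs hF0Sk) hFASk
  have c1 := Finset.card_le_card hsub
  rcases FA.eq_empty_or_nonempty with hE | ⟨v, hv⟩
  · have hE0 := Finset.card_eq_zero.2 hE
    omega
  · have hv' := hv
    simp only [hFA, Finset.mem_filter, Finset.mem_univ, true_and] at hv'
    obtain ⟨hvf, l, hl⟩ := hv'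
    obtain ⟨e, he1, he2, he3⟩ := H.extra_sink K hvf
    have heN : e ∉ T ∪ F0 ∪ FA := by
      intro h
      simp only [Finset.mem_union] at h
      rcases h with (h | h) | h
      · obtain ⟨w, hw, h1⟩ := hTB e h
        exact he3 w hw h1
      · simp only [hF0, Finset.mem_filter, Finset.mem_univ, true_and] at h
        have hne : v ≠ e := by rintro rfl; exact H.irr _ he2
        exact H.ltasymm he2 (H.F0_unique K h.1 h.2 hvf hne)
      · have : e = v := Finset.card_le_one.1 hFA1 e h v hv
        rw [this] at he2
        exact H.irr _ he2
    have c2 : (T ∪ F0 ∪ FA).card + 1 ≤ Sk.card := by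
      rw [← Finset.card_insert_of_notMem heN]
      apply Finset.card_le_card
      intro x hx
      rcases Finset.mem_insert.1 hx with rfl | hx
      · simp only [hSk, Finset.mem_filter, Finset.mem_univ, true_and]; exact he1
      · exact hsub hx
    have hU3 : U.card ≤ 3 := by
      rcases U.eq_empty_or_nonempty with hE | ⟨u, hu⟩
      · rw [hE]; simp
      · have hBne : {w | IsB K lt w}.Nonempty := by
          obtain ⟨w, hw, -⟩ := hτ2 u hu
          exact ⟨w, hw⟩
        obtain ⟨w, hw, hlast⟩ := H.exists_last _ hBne
        have hw' : IsB K lt w := hw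
        have hwU : w ∉ U := by
          intro h
          simp only [hU, Finset.mem_filter, Finset.mem_univ, true_and] at h
          obtain ⟨w', x, h1, h2, -⟩ := h
          exact hlast w' h2 h1
        have hvU : v ∉ U := by
          intro h
          simp only [hU, Finset.mem_filter, Finset.mem_univ, true_and] at h
          obtain ⟨w', x, h1, h2, -⟩ := h
          exact H.full_sink K hvf _ h2
        have hwv : w ≠ v := by rintro rfl; exact hw'.2 hvf
        have hs : insert w (insert v U) ⊆ Br := by
          intro x hx
          simp only [Finset.mem_insert] at hx
          rcases hx with rfl | rfl | hx
          · exact (mBr _).2 hw'.1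
          · exact (mBr _).2 ⟨l, hl⟩
          · exact hUBr hx
        have := Finset.card_le_card hs
        rw [Finset.card_insert_of_notMem (by simp [hwv, hwU]),
          Finset.card_insert_of_notMem hvU, cBr] at this
        omega
    omega

end BurlA

/-! ### Reduction -/

structure GP {V : Type} (G : SimpleGraph V) (S : Set V) (a b : V) (n : ℕ) (q : ℕ → V) : Prop where
  zero : q 0 = a
  last : ∀ t, n ≤ t → q t = b
  mem : ∀ t, q t ∈ S
  adj : ∀ t, t < n → G.Adj (q t) (q (t + 1))
  inj : ∀ s t, s ≤ n → t ≤ n → q s = q t → s = t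
  chord : ∀ s t, s ≤ n → t ≤ n → G.Adj (q s) (q t) → t = s + 1 ∨ s = t + 1

theorem GP.rev {V : Type} {G : SimpleGraph V} {S : Set V} {a b : V} {n : ℕ} {q : ℕ → V}
    (h : GP G S a b n q) : GP G S b a n (fun t => q (n - t)) where
  zero := h.last _ (by simp)
  last := fun t ht => by
    have : n - t = 0 := by omega
    simp only [this]; exact h.zero
  mem := fun t => h.mem _
  adj := fun t ht => by
    have := h.adj (n - (t + 1)) (by omega)
    have e : n - (t + 1) + 1 = n - t := by omega
    rw [e] at this
    exact this.symm
  inj := fun s t hs ht e => by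
    have := h.inj _ _ (by omega) (by omega) e
    omega
  chord := fun s t hs ht e => by
    have := h.chord _ _ (by omega) (by omega) e
    omega

theorem path_exists {V : Type} {G : SimpleGraph V} (S : Set V) {a b : V} (p : G.Walk a b)
    (hp : ∀ w ∈ p.support, w ∈ S) : ∃ n q, GP G S a b n q := by
  classical
  let Pr : ℕ → Prop := fun n => ∃ q : ℕ → V, q 0 = a ∧ (∀ t, n ≤ t → q t = b) ∧ (∀ t, q t ∈ S) ∧
    ∀ t, t < n → G.Adj (q t) (q (t + 1))
  have hex : ∃ n, Pr n := by
    refine ⟨p.length, p.getVert, by simp, fun t ht => p.getVert_of_length_le ht,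
      fun t => hp _ (p.getVert_mem_support t), fun t ht => p.adj_getVert_succ ht⟩
  have hmin := fun m => Nat.find_min' (m := m) hex
  obtain ⟨q, h0, hl, hm, ha⟩ := Nat.find_spec hex
  generalize Nat.find hex = n at *
  have inj : ∀ s t, s < t → t ≤ n → q s ≠ q t := by
    intro s t hst htn e
    have : Pr (n - (t - s)) := by
      refine ⟨fun r => if r ≤ s then q r else q (r + (t - s)), by simp [h0], ?_, ?_, ?_⟩
      · intro r hr
        dsimp only
        split_ifs with h
        · have h1 : r = s := by omega
          have h2 : n ≤ t := by omega
          rw [h1, e]; exact hl _ h2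
        · exact hl _ (by omega)
      · intro r; dsimp only; split_ifs <;> exact hm _
      · intro r hr
        dsimp only
        by_cases h : r ≤ s
        · rw [if_pos h]
          by_cases h' : r + 1 ≤ s
          · rw [if_pos h']; exact ha _ (by omega)
          · rw [if_neg h']
            have h1 : r = s := by omega
            have h2 : r + 1 + (t - s) = t + 1 := by omega
            rw [h2, h1, e]; exact ha _ (by omega)
        · rw [if_neg h, if_neg (by omega)]
          have h2 : r + 1 + (t - s) = r + (t - s) + 1 := by omega
          rw [h2]; exact ha _ (by omega)
    have := hmin _ this
    omega
  have chord : ∀ s t, s < t → t ≤ n → G.Adj (q s) (q t) → t = s + 1 := by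
    intro s t hst htn e
    by_contra hne
    have : Pr (n - (t - s - 1)) := by
      refine ⟨fun r => if r ≤ s then q r else q (r + (t - s - 1)), by simp [h0], ?_, ?_, ?_⟩
      · intro r hr
        dsimp only
        rw [if_neg (by omega)]
        exact hl _ (by omega)
      · intro r; dsimp only; split_ifs <;> exact hm _
      · intro r hr
        dsimp only
        by_cases h : r ≤ s
        · rw [if_pos h]
          by_cases h' : r + 1 ≤ s
          · rw [if_pos h']; exact ha _ (by omega)
          · rw [if_neg h']
            have h1 : r = s := by omega
            have h2 : r + 1 + (t - s - 1) = t := by omega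
            rw [h2, h1]; exact e
        · rw [if_neg h, if_neg (by omega)]
          have h2 : r + 1 + (t - s - 1) = r + (t - s - 1) + 1 := by omega
          rw [h2]; exact ha _ (by omega)
    have := hmin _ this
    omega
  refine ⟨n, q, h0, hl, hm, ha, ?_, ?_⟩
  · intro s t hs ht e
    rcases lt_trichotomy s t with h | h | h
    · exact absurd e (inj _ _ h ht)
    · exact h
    · exact absurd e.symm (inj _ _ h hs)
  · intro s t hs ht e
    rcases lt_trichotomy s t with h | h | h
    · exact Or.inl (chord _ _ h ht e)
    · subst h; exact absurd e (G.irrefl)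
    · exact Or.inr (chord _ _ h hs e.symm)

theorem sym_paths {V : Type} {G : SimpleGraph V} (S : Fin 5 → Fin 5 → Set V) (f : Fin 5 → V)
    (hS : ∀ i j, S i j = S j i) (h : ∀ i j, i ≠ j → ∃ n q, GP G (S i j) (f i) (f j) n q) :
    ∃ (N : Fin 5 → Fin 5 → ℕ) (Q : Fin 5 → Fin 5 → ℕ → V), (∀ i j, N i j = N j i) ∧
      (∀ i j t, i ≠ j → t ≤ N i j → Q j i t = Q i j (N i j - t)) ∧
      (∀ i t, Q i i t = f i) ∧
      ∀ i j, i ≠ j → GP G (S i j) (f i) (f j) (N i j) (Q i j) := by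
  have : Nonempty V := ⟨f 0⟩
  choose! n0 q0 hg using h
  refine ⟨fun i j => if i < j then n0 i j else if j < i then n0 j i else 0,
    fun i j t => if i < j then q0 i j t else if j < i then q0 j i (n0 j i - t) else f i, ?_, ?_, ?_, ?_⟩
  · intro i j
    dsimp only
    rcases lt_trichotomy i j with h | h | h
    · rw [if_pos h, if_neg h.asymm, if_pos h]
    · subst h; rfl
    · rw [if_pos h, if_neg h.asymm, if_pos h]
  · intro i j t hij
    dsimp only
    rcases lt_or_gt_of_ne hij with h | h
    · simp only [if_pos h, if_neg h.asymm]
      intro _; trivial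
    · simp only [if_pos h, if_neg h.asymm]
      intro ht
      congr 1; omega
  · intro i t; simp
  · intro i j hij
    rcases lt_or_gt_of_ne hij with h | h
    · simp only [if_pos h]; exact hg i j hij
    · simp only [if_pos h, if_neg h.asymm]
      rw [hS i j]; exact (hg j i hij.symm).rev

theorem K5S_exists {V : Type} {G : SimpleGraph V} (h : IsSubdivision G (⊤ : SimpleGraph (Fin 5))) :
    ∃ X : Set V, Nonempty (K5S (G.comap (Subtype.val : X → V))) := by
  obtain ⟨f, P, hP1, hP2, hP3, hP4, hP5⟩ := h
  let S : Fin 5 → Fin 5 → Set V := fun i j =>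
    {w | ∃ u v, ∃ h : (⊤ : SimpleGraph (Fin 5)).Adj u v, ((u = i ∧ v = j) ∨ (u = j ∧ v = i)) ∧
      w ∈ (P h).support}
  have hS : ∀ i j, S i j = S j i := by
    intro i j; ext w
    constructor
    · rintro ⟨u, v, h, h1, h2⟩; exact ⟨u, v, h, h1.symm, h2⟩
    · rintro ⟨u, v, h, h1, h2⟩; exact ⟨u, v, h, h1.symm, h2⟩
  have hSa : ∀ i j l, f l ∈ S i j → l = i ∨ l = j := by
    rintro i j l ⟨u, v, h, h1, h2⟩
    have := hP2 h l h2
    rcases h1 with ⟨rfl, rfl⟩ | ⟨rfl, rfl⟩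
    · exact this
    · exact this.symm
  have hSb : ∀ i j k l w, w ∈ S i j → w ∈ S k l →
      (k = i ∧ l = j) ∨ (k = j ∧ l = i) ∨ ∃ x, w = f x := by
    rintro i j k l w ⟨u, v, h, h1, h2⟩ ⟨u', v', h', h1', h2'⟩
    by_cases he : s(u, v) = s(u', v')
    · rw [Sym2.eq_iff] at he
      grind
    · exact Or.inr (Or.inr (hP3 h h' he w h2 h2'))
  have hSc : ∀ x y, G.Adj x y → ∃ i j, i ≠ j ∧ x ∈ S i j ∧ y ∈ S i j := by
    intro x y hxy
    obtain ⟨u, v, h, he⟩ := hP5 hxy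
    exact ⟨u, v, h.ne, ⟨u, v, h, Or.inl ⟨rfl, rfl⟩, Walk.fst_mem_support_of_mem_edges _ he⟩,
      ⟨u, v, h, Or.inl ⟨rfl, rfl⟩, Walk.snd_mem_support_of_mem_edges _ he⟩⟩
  obtain ⟨N, Q, hN, hQs, hQi, hg⟩ := sym_paths S f hS (by
    intro i j hij
    have h : (⊤ : SimpleGraph (Fin 5)).Adj i j := hij
    exact path_exists (S i j) (P h) (fun w hw => ⟨i, j, h, Or.inl ⟨rfl, rfl⟩, hw⟩))
  clear hP1 hP2 hP3 hP4 hP5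
  have hne : ∀ i : Fin 5, i ≠ i + 1 := by decide
  -- a vertex of X in S k l is on the chosen path
  have hon : ∀ i j t k l, k ≠ l → Q i j t ∈ S k l → ∃ s, s ≤ N k l ∧ Q i j t = Q k l s := by
    intro i j t k l hkl hm
    have hbr : ∀ x, f x ∈ S k l → ∃ s, s ≤ N k l ∧ f x = Q k l s := by
      intro x hx
      rcases hSa _ _ _ hx with rfl | rfl
      · exact ⟨0, Nat.zero_le _, (hg _ _ hkl).zero.symm⟩
      · exact ⟨_, le_rfl, ((hg _ _ hkl).last _ le_rfl).symm⟩
    have hbr' : (∃ x, Q i j t = f x) → ∃ s, s ≤ N k l ∧ Q i j t = Q k l s := by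
      rintro ⟨x, hx⟩
      rw [hx] at hm ⊢; exact hbr x hm
    by_cases hij : i = j
    · subst hij; exact hbr' ⟨i, hQi i t⟩
    by_cases ht : t ≤ N i j
    · rcases hSb i j k l _ ((hg i j hij).mem t) hm with ⟨rfl, rfl⟩ | ⟨rfl, rfl⟩ | h
      · exact ⟨t, ht, rfl⟩
      · refine ⟨N k l - t, by omega, ?_⟩
        exact hQs k l t hkl (by rw [hN k l]; exact ht)
      · exact hbr' h
    · exact hbr' ⟨j, (hg i j hij).last t (by omega)⟩
  refine ⟨{w | ∃ i j t, w = Q i j t}, ⟨{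
    br := fun i => ⟨f i, i, i, 0, (hQi i 0).symm⟩
    n := N
    q := fun i j t => ⟨Q i j t, i, j, t, rfl⟩
    br_inj := fun i j h => f.injective (congrArg Subtype.val h)
    n_symm := hN
    n_pos := ?_
    q_symm := fun i j t hij ht => Subtype.ext (hQs i j t hij ht)
    q_zero := fun i j hij => Subtype.ext (hg i j hij).zero
    q_inj := fun i j s t hij hs ht h => (hg i j hij).inj s t hs ht (congrArg Subtype.val h)
    q_disj := ?_
    q_br := ?_
    adj := ?_
    cover := ?_ }⟩⟩
  · intro i j hij
    rcases Nat.eq_zero_or_pos (N i j) with h | h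
    · have h1 := (hg i j hij).last 0 (by omega)
      rw [(hg i j hij).zero] at h1
      exact absurd (f.injective h1) hij
    · exact h
  · intro i j k l s t hij hkl hs ht h
    have h' : Q i j s = Q k l t := congrArg Subtype.val h
    have := (hg k l hkl).mem t
    rw [← h'] at this
    rcases hSb i j k l _ ((hg i j hij).mem s) this with h | h | ⟨x, h⟩
    · exact Or.inl h
    · exact Or.inr (Or.inl h)
    · exact Or.inr (Or.inr ⟨x, Subtype.ext h⟩)
  · intro i j s x hij hs h
    have h' : Q i j s = f x := congrArg Subtype.val h
    have := (hg i j hij).mem s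
    rw [h'] at this
    exact hSa _ _ _ this
  · rintro ⟨x, i, j, t, rfl⟩ ⟨y, i', j', t', rfl⟩
    rw [SimpleGraph.comap_adj]
    constructor
    · intro hxy
      obtain ⟨k, l, hkl, hx, hy⟩ := hSc _ _ hxy
      obtain ⟨s, hs, hxs⟩ := hon _ _ _ _ _ hkl hx
      obtain ⟨r, hr, hyr⟩ := hon _ _ _ _ _ hkl hy
      have hxy' : G.Adj (Q k l s) (Q k l r) := by rw [← hxs, ← hyr]; exact hxy
      rcases (hg k l hkl).chord s r hs hr hxy' with h | h
      · subst h
        exact ⟨k, l, s, hkl, hr, Subtype.ext hxs, Subtype.ext hyr⟩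
      · subst h
        refine ⟨l, k, N k l - (r + 1), hkl.symm, by rw [hN l k]; omega, Subtype.ext ?_,
          Subtype.ext ?_⟩
        · change Q i j t = Q l k (N k l - (r + 1))
          rw [hxs, hQs l k (r + 1) hkl.symm (by rw [hN l k]; omega), hN l k]
        · change Q i' j' t' = Q l k (N k l - (r + 1) + 1)
          rw [hyr, hQs l k r hkl.symm (by rw [hN l k]; omega), hN l k]
          congr 1; omega
    · rintro ⟨k, l, s, hkl, hs, hx, hy⟩
      have hx' : Q i j t = Q k l s := congrArg Subtype.val hx
      have hy' : Q i' j' t' = Q k l (s + 1) := congrArg Subtype.val hy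
      change G.Adj (Q i j t) (Q i' j' t')
      rw [hx', hy']; exact (hg k l hkl).adj s hs
  · rintro ⟨w, i, j, t, rfl⟩
    by_cases hij : i = j
    · subst hij
      refine ⟨i, i + 1, 0, hne i, Nat.zero_le _, Subtype.ext ?_⟩
      exact (hQi i t).trans (hg _ _ (hne i)).zero.symm
    by_cases ht : t ≤ N i j
    · exact ⟨i, j, t, hij, ht, rfl⟩
    · refine ⟨i, j, N i j, hij, le_rfl, Subtype.ext ?_⟩
      exact ((hg i j hij).last t (by omega)).trans ((hg i j hij).last _ le_rfl).symm

theorem BurlA_exists {V : Type} {G : SimpleGraph V} (h : IsBurlingGraph G) (X : Set V) :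
    ∃ A lt, BurlA (G.comap (Subtype.val : X → V)) A lt := by
  obtain ⟨A, ⟨hA1, hA2⟩, V', T, g, hg⟩ := h
  refine ⟨fun x y => A x.1 y.1, fun x y => tlt T (g x.1) (g y.1), ?_, ?_, ?_, ?_, ?_, ?_, ?_⟩
  · intro x y
    rw [SimpleGraph.comap_adj]
    constructor
    · intro h
      by_cases h' : A y.1 x.1
      · exact Or.inr h'
      · exact Or.inl ((hA2 _ _ h).2 h')
    · rintro (h | h)
      · exact hA1 _ _ h
      · exact (hA1 _ _ h).symm
  · intro u v w h h' hne
    exact arc_B1 T ((hg _ _).1 h) ((hg _ _).1 h')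
      (fun e => hne (Subtype.ext (g.injective e)))
  · intro x v y h h'
    exact arc_B2 T h ((hg _ _).1 h')
  · intro x v y h h'
    rcases arc_B3 T h ((hg _ _).1 h') with h | h
    · exact Or.inl h
    · exact Or.inr ((hg _ _).2 h)
  · intro u h
    exact arc_acyclic T (g u.1) (Relation.TransGen.lift (fun x : X => g x.1)
      (fun a b hab => (hg _ _).1 hab) u u h)
  · intro x y z h h'
    exact tlt_trans T h h'
  · intro x h
    exact h.2 rfl

/-- no subdivision of `K₅` is a Burling graph. -/
theorem no_K5_subdivision_is_Burling (V : Type) (G : SimpleGraph V)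
    (h : IsSubdivision G (⊤ : SimpleGraph (Fin 5))) : ¬ IsBurlingGraph G := by
  intro hB
  obtain ⟨X, ⟨K⟩⟩ := K5S_exists h
  obtain ⟨A, lt, H⟩ := BurlA_exists hB X
  exact H.main_count K

end BurlingFormal
end

section
/- K_n is not weakly pervasive for every n ≥ 5. -/
namespace BurlingFormal

open SimpleGraph

/-- Abstract Burling structure on a type. -/
structure BSet {X : Type} (arc lt : X → X → Prop) : Prop where
  irr : ∀ x, ¬ lt x x
  tr : ∀ x y z, lt x y → lt y z → lt x z
  ax1 : ∀ x y a, lt x a → arc x y → lt y a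
  ax2 : ∀ x y a, lt y a → arc x y → arc x a ∨ lt x a
  ax3 : ∀ x y z, arc x y → arc x z → y ≠ z → lt y z ∨ lt z y
  rk : ∃ r : X → ℕ, ∀ x y, arc x y → r y < r x

/-- Induced path from `a` to `b` with interior `I`. -/
def IPath {X : Type} (adj : X → X → Prop) (a b : X) (I : Set X) : Prop :=
  ∃ (l : ℕ) (g : ℕ → X), 1 ≤ l ∧ g 0 = a ∧ g l = b ∧
    (∀ k, k < l → adj (g k) (g (k+1))) ∧
    (∀ k m, k ≤ l → m ≤ l → adj (g k) (g m) → m = k + 1 ∨ k = m + 1) ∧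
    (∀ k m, k ≤ l → m ≤ l → g k = g m → k = m) ∧
    (∀ x, x ∈ I ↔ ∃ k, 0 < k ∧ k < l ∧ g k = x)

section
variable {X : Type} {adj : X → X → Prop}

lemma IPath.rev {a b : X} {I : Set X} (sy : ∀ x y, adj x y → adj y x) (h : IPath adj a b I) :
    IPath adj b a I := by
  obtain ⟨l, g, hl, h0, h1, h2, h3, h4, h5⟩ := h
  refine ⟨l, fun k => g (l - k), hl, by simpa, by simpa, ?_, ?_, ?_, ?_⟩
  · intro k hk
    have := sy _ _ (h2 (l - (k+1)) (by omega))
    rwa [show l - (k+1) + 1 = l - k by omega] at this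
  · intro k m hk hm h
    have := h3 _ _ (by omega) (by omega) h
    omega
  · intro k m hk hm h
    have := h4 _ _ (by omega) (by omega) h
    omega
  · intro x
    rw [h5]
    constructor
    · rintro ⟨k, a, b, c⟩
      exact ⟨l - k, by omega, by omega, by show g (l-(l-k)) = x; rw [show l-(l-k)=k by omega]; exact c⟩
    · rintro ⟨k, a, b, c⟩
      exact ⟨l - k, by omega, by omega, c⟩

lemma up_prop {D Z : X → Prop} (cl : ∀ x y, D x → adj x y → D y ∨ Z y) {g : ℕ → X} {l : ℕ}
    (h2 : ∀ k, k < l → adj (g k) (g (k+1))) (k m : ℕ) (hkm : k ≤ m) (hm : m ≤ l)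
    (hD : D (g k)) (hZ : ∀ t, k < t → t < m → ¬ Z (g t)) : D (g m) ∨ Z (g m) := by
  induction m, hkm using Nat.le_induction with
  | base => exact Or.inl hD
  | succ m hkm ih =>
    have h := ih (by omega) (fun t a b => hZ t a (by omega))
    rcases Nat.eq_or_lt_of_le hkm with e | e
    · subst e; exact cl _ _ hD (h2 _ (by omega))
    · exact cl _ _ (h.resolve_right (hZ m e (by omega))) (h2 _ (by omega))

lemma C2 {D Z : X → Prop} (cl : ∀ x y, D x → adj x y → D y ∨ Z y) {a b : X} {I : Set X}
    (h : IPath adj a b I) (hZ : ∀ x ∈ I, ¬ Z x) (ha : D a) :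
    (∀ x ∈ I, D x) ∧ (D b ∨ Z b) := by
  obtain ⟨l, g, hl, h0, h1, h2, h3, h4, h5⟩ := h
  subst h0 h1
  have hZ' : ∀ t, 0 < t → t < l → ¬ Z (g t) := fun t a b => hZ _ ((h5 _).2 ⟨t, a, b, rfl⟩)
  refine ⟨?_, up_prop cl h2 0 l (by omega) le_rfl ha hZ'⟩
  intro x hx
  obtain ⟨k, k0, kl, rfl⟩ := (h5 _).1 hx
  exact (up_prop cl h2 0 k (by omega) (by omega) ha
    (fun t a b => hZ' t a (by omega))).resolve_right (hZ' k k0 kl)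

lemma C1a {D Z : X → Prop} (cl : ∀ x y, D x → adj x y → D y ∨ Z y) {a b : X} {I : Set X}
    (h : IPath adj a b I) (hZ : ∀ x ∈ I, ¬ Z x) {x : X} (hx : x ∈ I) (hD : D x) :
    (D b ∨ Z b) := by
  obtain ⟨l, g, hl, h0, h1, h2, h3, h4, h5⟩ := h
  subst h0 h1
  have hZ' : ∀ t, 0 < t → t < l → ¬ Z (g t) := fun t a b => hZ _ ((h5 _).2 ⟨t, a, b, rfl⟩)
  obtain ⟨k, k0, kl, rfl⟩ := (h5 _).1 hx
  exact up_prop cl h2 k l (by omega) (by omega) hD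
    (fun t a b => hZ' t (by omega) (by omega))

/-- the rest of the interior, upwards or downwards -/
lemma C1b (sy : ∀ x y, adj x y → adj y x)
    {D Z : X → Prop} (cl : ∀ x y, D x → adj x y → D y ∨ Z y) {a b : X} {I : Set X}
    (h : IPath adj a b I) (hZ : ∀ x ∈ I, ¬ Z x) {x : X} (hx : x ∈ I) (hD : D x) :
    ∀ y ∈ I, D y := by
  have key : ∀ (g : ℕ → X) (l : ℕ), (∀ k, k < l → adj (g k) (g (k+1))) →
      (∀ x, x ∈ I ↔ ∃ k, 0 < k ∧ k < l ∧ g k = x) → ∀ k m, 0 < k → k ≤ m → m < l → D (g k) →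
      D (g m) := by
    intro g l h2 h5 k m h0 h1 hm hk
    have hZ' : ∀ t, 0 < t → t < l → ¬ Z (g t) := fun t a b => hZ _ ((h5 _).2 ⟨t, a, b, rfl⟩)
    exact (up_prop cl h2 k m h1 hm.le hk (fun t a b => hZ' t (by omega) (by omega))).resolve_right
      (hZ' m (by omega) hm)
  intro y hy
  obtain ⟨l, g, hl, h0, h1, h2, h3, h4, h5⟩ := h
  obtain ⟨k, k0, kl, rfl⟩ := (h5 _).1 hx
  obtain ⟨m, m0, ml, rfl⟩ := (h5 _).1 hy
  rcases le_total k m with e | e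
  · exact key g l h2 h5 k m k0 e ml hD
  · have := key (fun k => g (l - k)) l (by
      intro k hk
      have := sy _ _ (h2 (l - (k+1)) (by omega))
      rwa [show l - (k+1) + 1 = l - k by omega] at this) (by
      intro x
      rw [h5]
      constructor
      · rintro ⟨k, a, b, c⟩
        exact ⟨l - k, by omega, by omega, by show g (l-(l-k)) = x; rw [show l-(l-k)=k by omega]; exact c⟩
      · rintro ⟨k, a, b, c⟩
        exact ⟨l - k, by omega, by omega, c⟩) (l - k) (l - m) (by omega) (by omega) (by omega)
      (by show D (g (l - (l - k))); rwa [show l - (l - k) = k by omega])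
    simpa only [show l - (l - m) = m by omega] using this

lemma C3 {D Z : X → Prop} (cl : ∀ x y, D x → adj x y → D y ∨ Z y) {a b : X} {I : Set X}
    (h : IPath adj a b I) (hZ : ∀ x, Z x → adj a x) (hDa : ∀ x, D x → ¬ adj a x)
    {x : X} (hx : x ∈ I) (hD : D x) : D b := by
  obtain ⟨l, g, hl, h0, h1, h2, h3, h4, h5⟩ := h
  subst h0 h1
  obtain ⟨k, k0, kl, rfl⟩ := (h5 _).1 hx
  have hk : k ≠ 1 := by
    rintro rfl
    exact hDa _ hD (h2 0 (by omega))
  have hZ' : ∀ t, k < t → t ≤ l → ¬ Z (g t) := by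
    intro t a b z
    have := h3 0 t (by omega) b (hZ _ z)
    omega
  exact (up_prop cl h2 k l (by omega) (by omega) hD
    (fun t a b => hZ' t (by omega) (by omega))).resolve_right (hZ' l kl le_rfl)

lemma C4up {D Z : X → Prop} (cl : ∀ x y, D x → adj x y → D y ∨ Z y) {g : ℕ → X} {l m k : ℕ}
    (h2 : ∀ k, k < l → adj (g k) (g (k+1)))
    (h3 : ∀ k m, k ≤ l → m ≤ l → adj (g k) (g m) → m = k + 1 ∨ k = m + 1)
    (hm : m < k) (hk : k ≤ l)
    (hZ : ∀ x, Z x → adj (g m) x) (hDa : ∀ x, D x → ¬ adj (g m) x)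
    (hD : D (g k)) : D (g l) := by
  have hk' : k ≠ m + 1 := by
    rintro rfl
    exact hDa _ hD (h2 m (by omega))
  have hZ' : ∀ t, k < t → t ≤ l → ¬ Z (g t) := by
    intro t a b z
    have := h3 m t (by omega) b (hZ _ z)
    omega
  rcases Nat.eq_or_lt_of_le hk with e | e
  · rwa [← e]
  exact (up_prop cl h2 k l (by omega) (by omega) hD
    (fun t a b => hZ' t (by omega) (by omega))).resolve_right (hZ' l e le_rfl)

lemma C4 (sy : ∀ x y, adj x y → adj y x)
    {D Z : X → Prop} (cl : ∀ x y, D x → adj x y → D y ∨ Z y) {a b q : X} {I : Set X}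
    (h : IPath adj a b I) (hq : q ∈ I) (hqD : ¬ D q)
    (hZ : ∀ x, Z x → adj q x) (hDa : ∀ x, D x → ¬ adj q x)
    {x : X} (hx : x ∈ I) (hD : D x) : D a ∨ D b := by
  obtain ⟨l, g, hl, h0, h1, h2, h3, h4, h5⟩ := h
  subst h0 h1
  obtain ⟨k, k0, kl, rfl⟩ := (h5 _).1 hx
  obtain ⟨m, m0, ml, rfl⟩ := (h5 _).1 hq
  have : k ≠ m := by rintro rfl; exact hqD hD
  rcases lt_or_gt_of_ne this with e | e
  · left
    have := C4up (g := fun k => g (l - k)) (l := l) (m := l - m) (k := l - k) cl (by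
      intro k hk
      have := sy _ _ (h2 (l - (k+1)) (by omega))
      rwa [show l - (k+1) + 1 = l - k by omega] at this) (by
      intro k m hk hm h
      have := h3 _ _ (by omega) (by omega) h
      omega) (by omega) (by omega) (by simpa only [show l - (l - m) = m by omega])
      (by simpa only [show l - (l - m) = m by omega])
      (by simpa only [show l - (l - k) = k by omega])
    simpa using this
  · right
    exact C4up cl h2 h3 e kl.le hZ hDa hD

lemma C5dn (sy : ∀ x y, adj x y → adj y x)
    {D Z : X → Prop} (cl : ∀ x y, D x → adj x y → D y ∨ Z y) {g : ℕ → X} {l m k : ℕ}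
    (h2 : ∀ k, k < l → adj (g k) (g (k+1)))
    (h3 : ∀ k m, k ≤ l → m ≤ l → adj (g k) (g m) → m = k + 1 ∨ k = m + 1)
    (hm : m < k) (hk : k < l)
    (hZ : ∀ x, Z x → adj (g m) x)
    (hD : D (g l) ∨ Z (g l)) : D (g k) ∨ Z (g k) := by
  have hD : D (g l) := hD.resolve_right (by
    intro z
    have := h3 _ _ (by omega) le_rfl (hZ _ z)
    omega)
  have hZ' : ∀ t, k < t → t ≤ l → ¬ Z (g t) := by
    intro t a b z
    have := h3 m t (by omega) b (hZ _ z)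
    omega
  have := up_prop (g := fun k => g (l - k)) (l := l) cl (by
      intro k hk
      have := sy _ _ (h2 (l - (k+1)) (by omega))
      rwa [show l - (k+1) + 1 = l - k by omega] at this) 0 (l - k) (by omega) (by omega)
      (by simpa using hD) (by
        intro t a b
        exact hZ' _ (by omega) (by omega))
  simpa only [show l - (l - k) = k by omega] using this

lemma C5 (sy : ∀ x y, adj x y → adj y x)
    {D Z : X → Prop} (cl : ∀ x y, D x → adj x y → D y ∨ Z y) {a b q q' : X} {I : Set X}
    (h : IPath adj a b I) (hq : q ∈ I) (hq' : q' ∈ I) (hne : q ≠ q')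
    (hZ : ∀ x, Z x → adj q x) (ha : D a ∨ Z a) (hb : D b ∨ Z b) : D q' ∨ Z q' := by
  obtain ⟨l, g, hl, h0, h1, h2, h3, h4, h5⟩ := h
  subst h0 h1
  obtain ⟨k, k0, kl, rfl⟩ := (h5 _).1 hq'
  obtain ⟨m, m0, ml, rfl⟩ := (h5 _).1 hq
  have : k ≠ m := by rintro rfl; exact hne rfl
  rcases lt_or_gt_of_ne this with e | e
  · have := C5dn (g := fun k => g (l - k)) (l := l) (m := l - m) (k := l - k) sy cl (by
      intro k hk
      have := sy _ _ (h2 (l - (k+1)) (by omega))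
      rwa [show l - (k+1) + 1 = l - k by omega] at this) (by
      intro k m hk hm h
      have := h3 _ _ (by omega) (by omega) h
      omega) (by omega) (by omega) (by simpa only [show l - (l - m) = m by omega])
      (by simpa using ha)
    simpa only [show l - (l - k) = k by omega] using this
  · exact C5dn sy cl h2 h3 e kl hZ hb

/-- An endpoint has a neighbour along the path. -/
lemma IPath.first {a b : X} {I : Set X} (h : IPath adj a b I) :
    ∃ y, adj a y ∧ ((y ∈ I) ∨ (y = b ∧ I = ∅)) := by
  obtain ⟨l, g, hl, h0, h1, h2, h3, h4, h5⟩ := h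
  subst h0 h1
  refine ⟨g 1, h2 0 (by omega), ?_⟩
  by_cases hl1 : l = 1
  · subst hl1
    refine Or.inr ⟨rfl, ?_⟩
    ext x; rw [h5]; simp only [Set.mem_empty_iff_false, iff_false]; rintro ⟨k, a, b, _⟩; omega
  · exact Or.inl ((h5 _).2 ⟨1, by omega, by omega, rfl⟩)

lemma IPath.adj_empty {a b : X} {I : Set X} (h : IPath adj a b I) (hab : adj a b) :
    I = ∅ := by
  obtain ⟨l, g, hl, h0, h1, h2, h3, h4, h5⟩ := h
  subst h0 h1
  have := h3 _ _ (by omega) (by omega) hab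
  have : l = 1 := by omega
  subst this
  ext x; rw [h5]; simp only [Set.mem_empty_iff_false, iff_false]; rintro ⟨k, a, b, _⟩; omega

/-- An interior vertex has two distinct neighbours. -/
lemma IPath.two (sy : ∀ x y, adj x y → adj y x) {a b x : X} {I : Set X}
    (h : IPath adj a b I) (hx : x ∈ I) :
    ∃ y z, y ≠ z ∧ adj x y ∧ adj x z ∧ (y ∈ I ∨ y = a ∨ y = b) ∧ (z ∈ I ∨ z = a ∨ z = b) := by
  obtain ⟨l, g, hl, h0, h1, h2, h3, h4, h5⟩ := h
  subst h0 h1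
  obtain ⟨k, k0, kl, rfl⟩ := (h5 _).1 hx
  have hmem : ∀ t, t ≤ l → (g t ∈ I ∨ g t = g 0 ∨ g t = g l) := by
    intro t ht
    by_cases h0 : t = 0
    · subst h0; simp
    by_cases h1 : t = l
    · subst h1; simp
    exact Or.inl ((h5 _).2 ⟨t, by omega, by omega, rfl⟩)
  refine ⟨g (k-1), g (k+1), ?_, ?_, h2 _ kl, hmem _ (by omega), hmem _ (by omega)⟩
  · intro h
    have := h4 _ _ (by omega) (by omega) h
    omega
  · have := h2 (k-1) (by omega)
    rw [show k - 1 + 1 = k by omega] at this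
    exact sy _ _ this
end

def AdjOf {X : Type} (arc : X → X → Prop) (x y : X) : Prop := arc x y ∨ arc y x

/-- Abstract induced subdivision of a complete graph. -/
structure Subd {X ι : Type} (adj : X → X → Prop) (f : ι → X) (I : ι → ι → Set X) : Prop where
  inj : ∀ i j, f i = f j → i = j
  cover : ∀ x, (∃ i, x = f i) ∨ ∃ i j, x ∈ I i j
  self : ∀ i j x, x ∈ I i j → i ≠ j
  symm : ∀ i j x, x ∈ I i j → x ∈ I j i
  path : ∀ i j, i ≠ j → IPath adj (f i) (f j) (I i j)
  fI : ∀ i j k, f k ∉ I i j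
  disj : ∀ i j k l x, x ∈ I i j → x ∈ I k l → (k = i ∧ l = j) ∨ (k = j ∧ l = i)
  nb : ∀ i j x y, x ∈ I i j → adj x y → y ∈ I i j ∨ y = f i ∨ y = f j

section
variable {X ι : Type} {arc lt : X → X → Prop} {f : ι → X} {I : ι → ι → Set X}

lemma AdjOf.sy : ∀ x y, AdjOf arc x y → AdjOf arc y x := fun _ _ h => Or.symm h

lemma BSet.arc_irr (B : BSet arc lt) (x : X) : ¬ arc x x := by
  obtain ⟨r, hr⟩ := B.rk
  intro h
  exact lt_irrefl _ (hr _ _ h)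

lemma BSet.arc_asymm (B : BSet arc lt) {x y : X} (h : arc x y) (h' : arc y x) : False := by
  obtain ⟨r, hr⟩ := B.rk
  exact lt_asymm (hr _ _ h) (hr _ _ h')

lemma BSet.nonadj (B : BSet arc lt) {x a : X} (h : lt x a) : ¬ AdjOf arc x a := by
  rintro (h' | h')
  · exact B.irr _ (B.ax1 _ _ _ h h')
  · rcases B.ax2 _ _ _ h h' with h'' | h''
    · exact B.arc_irr _ h''
    · exact B.irr _ h''

lemma BSet.cl (B : BSet arc lt) (a : X) :
    ∀ x y, lt x a → AdjOf arc x y → lt y a ∨ arc y a := by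
  rintro x y h (h' | h')
  · exact Or.inl (B.ax1 _ _ _ h h')
  · exact (B.ax2 _ _ _ h h').symm

lemma BSet.no2 (B : BSet arc lt) {q v : X} (h : lt v q ∨ arc v q) (h' : lt q v ∨ arc q v) :
    False := by
  rcases h with h | h <;> rcases h' with h' | h'
  · exact B.irr _ (B.tr _ _ _ h h')
  · exact B.nonadj h (Or.inr h')
  · exact B.nonadj h' (Or.inr h)
  · exact B.arc_asymm h h'

lemma nbClaim (B : BSet arc lt) (S : Subd (AdjOf arc) f I)
    (h3 : ∀ i j : ι, ∃ z, z ≠ i ∧ z ≠ j)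
    {i j : ι} {q x : X} (hq : q ∈ I i j) (hx : lt x q) :
    ∀ q' k l, q' ∈ I k l → q ≠ q' → lt q' q ∨ arc q' q := by
  have cl := B.cl q
  have hij := S.self _ _ _ hq
  have hZ : ∀ y, arc y q → AdjOf arc q y := fun y h => Or.inr h
  have hZ2 : ∀ y, arc y q → y ∈ I i j ∨ y = f i ∨ y = f j := fun y h => S.nb _ _ _ _ hq (hZ y h)
  have hZf : ∀ z, z ≠ i → z ≠ j → ¬ arc (f z) q := by
    intro z h1 h2 h
    rcases hZ2 _ h with h | h | h
    · exact S.fI _ _ _ h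
    · exact h1 (S.inj _ _ h)
    · exact h2 (S.inj _ _ h)
  have hZI : ∀ k l, ¬ ((k = i ∧ l = j) ∨ (k = j ∧ l = i)) → ∀ y ∈ I k l, ¬ arc y q := by
    intro k l hkl y hy h
    rcases hZ2 _ h with h | h | h
    · exact hkl (S.disj _ _ _ _ _ h hy)
    · subst h; exact S.fI _ _ _ hy
    · subst h; exact S.fI _ _ _ hy
  have A : ∀ k l, k ≠ l → ¬ ((k = i ∧ l = j) ∨ (k = j ∧ l = i)) → lt (f k) q →
      (∀ y ∈ I k l, lt y q) ∧ (lt (f l) q ∨ arc (f l) q) := by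
    intro k l hkl hp hD
    exact C2 (Z := fun y => arc y q) (D := fun y => lt y q) cl (S.path k l hkl) (hZI k l hp) hD
  have Bk : ∀ k, lt (f k) q → ∃ z, z ≠ i ∧ z ≠ j ∧ lt (f z) q := by
    intro k hk
    by_cases h : k ≠ i ∧ k ≠ j
    · exact ⟨k, h.1, h.2, hk⟩
    obtain ⟨z, hz1, hz2⟩ := h3 i j
    refine ⟨z, hz1, hz2, (A k z ?_ ?_ hk).2.resolve_right (hZf z hz1 hz2)⟩
    · rintro rfl; exact h ⟨hz1, hz2⟩
    · rintro (⟨_, h⟩ | ⟨_, h⟩)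
      · exact hz2 h
      · exact hz1 h
  have Bz : ∃ z, z ≠ i ∧ z ≠ j ∧ lt (f z) q := by
    rcases S.cover x with ⟨k, rfl⟩ | ⟨k, l, hxk⟩
    · exact Bk k hx
    have hkl := S.self _ _ _ hxk
    by_cases hp : (k = i ∧ l = j) ∨ (k = j ∧ l = i)
    · have hxij : x ∈ I i j := by
        rcases hp with ⟨rfl, rfl⟩ | ⟨rfl, rfl⟩
        · exact hxk
        · exact S.symm _ _ _ hxk
      rcases C4 AdjOf.sy (Z := fun y => arc y q) (D := fun y => lt y q) cl (S.path i j hij) hq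
        (B.irr q) hZ (fun y h h' => B.nonadj h h'.symm) hxij hx with h | h
      · exact Bk _ h
      · exact Bk _ h
    · have h1 := C1a (Z := fun y => arc y q) (D := fun y => lt y q) cl (S.path k l hkl)
        (hZI k l hp) hxk hx
      have h2 := C1a (Z := fun y => arc y q) (D := fun y => lt y q) cl (S.path l k hkl.symm)
        (hZI l k (by tauto)) (S.symm _ _ _ hxk) hx
      by_cases hk : k ≠ i ∧ k ≠ j
      · exact Bk k (h2.resolve_right (hZf k hk.1 hk.2))
      · have hl : l ≠ i ∧ l ≠ j := by
          constructor
          · rintro rfl; grind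
          · rintro rfl; grind
        exact Bk l (h1.resolve_right (hZf l hl.1 hl.2))
  obtain ⟨z, hz1, hz2, hz⟩ := Bz
  have Cz : ∀ z', z' ≠ i → z' ≠ j → lt (f z') q := by
    intro z' h1 h2
    by_cases e : z = z'
    · subst e; exact hz
    · exact (A z z' e (by grind) hz).2.resolve_right (hZf _ h1 h2)
  intro q' k l hq' hne
  have hkl := S.self _ _ _ hq'
  by_cases hp : (k = i ∧ l = j) ∨ (k = j ∧ l = i)
  · have hqij : q' ∈ I i j := by
      rcases hp with ⟨rfl, rfl⟩ | ⟨rfl, rfl⟩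
      · exact hq'
      · exact S.symm _ _ _ hq'
    exact C5 AdjOf.sy (Z := fun y => arc y q) (D := fun y => lt y q) cl (S.path i j hij) hq hqij
      hne hZ (A z i hz1 (by grind) hz).2 (A z j hz2 (by grind) hz).2
  · left
    by_cases hk : k ≠ i ∧ k ≠ j
    · exact (A k l hkl hp (Cz k hk.1 hk.2)).1 _ hq'
    · have hl : l ≠ i ∧ l ≠ j := by
        constructor
        · rintro rfl; grind
        · rintro rfl; grind
      exact (A l k hkl.symm (by tauto) (Cz l hl.1 hl.2)).1 _ (S.symm _ _ _ hq')

def Good (arc lt : X → X → Prop) (f : ι → X) (I : ι → ι → Set X) (α : ι) : Prop :=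
  ∀ x, lt x (f α) → ∃ i j, x ∈ I i j ∧ arc (f i) (f α) ∧ arc (f j) (f α) ∧
    ∀ y ∈ I i j, lt y (f α)

lemma brClaim (B : BSet arc lt) (S : Subd (AdjOf arc) f I) (α : ι) :
    Good arc lt f I α ∨ ∀ v, v ≠ α → lt (f v) (f α) ∨ arc (f v) (f α) := by
  rw [or_iff_not_imp_right]
  intro h
  push Not at h
  obtain ⟨v, hv, hvD, hvZ⟩ := h
  have cl := B.cl (f α)
  have hZI : ∀ k l, k ≠ α → l ≠ α → ∀ y ∈ I k l, ¬ arc y (f α) := by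
    intro k l hk hl y hy h
    rcases S.nb _ _ _ _ hy (Or.inl h) with h | h | h
    · exact S.fI _ _ _ h
    · exact hk (S.inj _ _ h).symm
    · exact hl (S.inj _ _ h).symm
  have hb : ∀ w, ¬ lt (f w) (f α) := by
    intro w hw
    have h1 : w ≠ α := by rintro rfl; exact B.irr _ hw
    have h2 : w ≠ v := by rintro rfl; exact hvD hw
    rcases (C2 (Z := fun y => arc y (f α)) (D := fun y => lt y (f α)) cl (S.path w v h2)
      (hZI w v h1 hv) hw).2 with h | h
    · exact hvD h
    · exact hvZ h
  intro x hx
  rcases S.cover x with ⟨w, rfl⟩ | ⟨i, j, hxi⟩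
  · exact (hb _ hx).elim
  have hij := S.self _ _ _ hxi
  have c3 : ∀ j, α ≠ j → x ∈ I α j → False := by
    intro j hj hxj
    exact hb j (C3 (Z := fun y => arc y (f α)) (D := fun y => lt y (f α)) cl (S.path α j hj)
      (fun y h => Or.inr h) (fun y h h' => B.nonadj h h'.symm) hxj hx)
  have hi : i ≠ α := by rintro rfl; exact c3 _ hij hxi
  have hj : j ≠ α := by rintro rfl; exact c3 _ hij.symm (S.symm _ _ _ hxi)
  refine ⟨i, j, hxi, ?_, ?_, ?_⟩
  · exact (C1a (Z := fun y => arc y (f α)) (D := fun y => lt y (f α)) cl (S.path j i hij.symm)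
      (hZI j i hj hi) (S.symm _ _ _ hxi) hx).resolve_left (hb _)
  · exact (C1a (Z := fun y => arc y (f α)) (D := fun y => lt y (f α)) cl (S.path i j hij)
      (hZI i j hi hj) hxi hx).resolve_left (hb _)
  · exact C1b AdjOf.sy (Z := fun y => arc y (f α)) (D := fun y => lt y (f α)) cl (S.path i j hij)
      (hZI i j hi hj) hxi hx

def Apex (arc lt : X → X → Prop) (f : ι → X) (I : ι → ι → Set X) (a b c : ι) : Prop :=
  arc (f b) (f a) ∧ arc (f c) (f a) ∧ (∃ y, y ∈ I b c) ∧ ∀ y ∈ I b c, lt y (f a)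

lemma Apex.swap (S : Subd (AdjOf arc) f I) {a b c : ι} (h : Apex arc lt f I a b c) :
    Apex arc lt f I a c b :=
  ⟨h.2.1, h.1, h.2.2.1.imp fun _ h => S.symm _ _ _ h, fun y hy => h.2.2.2 y (S.symm _ _ _ hy)⟩

lemma triangle [Finite X] (B : BSet arc lt) (S : Subd (AdjOf arc) f I) {u v w : ι}
    (huv : u ≠ v) (huw : u ≠ w) (hvw : v ≠ w)
    (gu : Good arc lt f I u) (gv : Good arc lt f I v) (gw : Good arc lt f I w)
    (e1 : ∀ y ∈ I u v, ∀ x, ¬ lt x y) (e2 : ∀ y ∈ I u w, ∀ x, ¬ lt x y)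
    (e3 : ∀ y ∈ I v w, ∀ x, ¬ lt x y) :
    Apex arc lt f I u v w ∨ Apex arc lt f I v u w ∨ Apex arc lt f I w u v := by
  obtain ⟨r, hr⟩ := B.rk
  let C : Set X := {x | x = f u ∨ x = f v ∨ x = f w ∨ x ∈ I u v ∨ x ∈ I u w ∨ x ∈ I v w}
  have hC : C.Nonempty := ⟨f u, Or.inl rfl⟩
  obtain ⟨s, hs, hmax⟩ := Set.exists_max_image C r (Set.toFinite C) hC
  -- endpoints
  have first2 : ∀ a b c, a ≠ b → a ≠ c → b ≠ c → ∃ y z, y ≠ z ∧ AdjOf arc (f a) y ∧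
      AdjOf arc (f a) z ∧ (y ∈ I a b ∨ y = f b) ∧ (z ∈ I a c ∨ z = f c) := by
    intro a b c hab hac hbc
    obtain ⟨y, hy, hy'⟩ := (S.path a b hab).first
    obtain ⟨z, hz, hz'⟩ := (S.path a c hac).first
    refine ⟨y, z, ?_, hy, hz, ?_, ?_⟩
    · rintro rfl
      rcases hy' with h | ⟨h, _⟩ <;> rcases hz' with h' | ⟨h', _⟩
      · have := S.disj _ _ _ _ _ h h'; grind
      · subst h'; exact S.fI _ _ _ h
      · subst h; exact S.fI _ _ _ h'
      · exact hbc (S.inj _ _ (h.symm.trans h'))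
    · exact hy'.imp id And.left
    · exact hz'.imp id And.left
  have two : ∃ y z, y ≠ z ∧ AdjOf arc s y ∧ AdjOf arc s z ∧ y ∈ C ∧ z ∈ C := by
    have sm := S.symm
    have aux : ∀ a b c, a ≠ b → a ≠ c → b ≠ c → s = f a → (∀ y, y ∈ I a b ∨ y = f b → y ∈ C) →
        (∀ y, y ∈ I a c ∨ y = f c → y ∈ C) →
        ∃ y z, y ≠ z ∧ AdjOf arc s y ∧ AdjOf arc s z ∧ y ∈ C ∧ z ∈ C := by
      intro a b c h1 h2 h3 h4 h5 h6
      obtain ⟨y, z, g1, g2, g3, g4, g5⟩ := first2 a b c h1 h2 h3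
      exact ⟨y, z, g1, h4 ▸ g2, h4 ▸ g3, h5 _ g4, h6 _ g5⟩
    have aux2 : ∀ a b, a ≠ b → s ∈ I a b → (∀ y, y ∈ I a b ∨ y = f a ∨ y = f b → y ∈ C) →
        ∃ y z, y ≠ z ∧ AdjOf arc s y ∧ AdjOf arc s z ∧ y ∈ C ∧ z ∈ C := by
      intro a b h1 h2 h3
      obtain ⟨y, z, g1, g2, g3, g4, g5⟩ := (S.path a b h1).two AdjOf.sy h2
      exact ⟨y, z, g1, g2, g3, h3 _ g4, h3 _ g5⟩
    have s1 := sm v u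
    have s2 := sm w u
    have s3 := sm w v
    have hCm : ∀ x, x ∈ C ↔
      (x = f u ∨ x = f v ∨ x = f w ∨ x ∈ I u v ∨ x ∈ I u w ∨ x ∈ I v w) := fun x => Iff.rfl
    rcases hs with h | h | h | h | h | h
    · exact aux u v w huv huw hvw h (by intro y; rw [hCm]; tauto) (by intro y; rw [hCm]; tauto)
    · exact aux v u w huv.symm hvw huw h
        (by intro y; rw [hCm]; have := s1 y; tauto) (by intro y; rw [hCm]; tauto)
    · exact aux w u v huw.symm hvw.symm huv h
        (by intro y; rw [hCm]; have := s2 y; tauto) (by intro y; rw [hCm]; have := s3 y; tauto)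
    · exact aux2 u v huv h (by intro y; rw [hCm]; tauto)
    · exact aux2 u w huw h (by intro y; rw [hCm]; tauto)
    · exact aux2 v w hvw h (by intro y; rw [hCm]; tauto)
  have : ∃ q t, q ∈ C ∧ t ∈ C ∧ lt q t := by
    obtain ⟨y, z, hne, hy, hz, hyC, hzC⟩ := two
    have hy := hy.resolve_right (fun h => absurd (hr _ _ h) (not_lt.2 (hmax _ hyC)))
    have hz := hz.resolve_right (fun h => absurd (hr _ _ h) (not_lt.2 (hmax _ hzC)))
    rcases B.ax3 _ _ _ hy hz hne with h | h
    · exact ⟨y, z, hyC, hzC, h⟩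
    · exact ⟨z, y, hzC, hyC, h⟩
  obtain ⟨q, t, hq, ht, hqt⟩ := this
  have fin : ∀ a b c, Good arc lt f I a → (q = f a ∨ q = f b ∨ q = f c ∨ q ∈ I a b ∨
      q ∈ I a c ∨ q ∈ I b c) → t = f a → Apex arc lt f I a b c := by
    intro a b c g hq e
    subst e
    obtain ⟨i, j, h1, h2, h3, h4⟩ := g q hqt
    rcases hq with h | h | h | h | h | h
    · exact (S.fI _ _ _ (h ▸ h1)).elim
    · exact (S.fI _ _ _ (h ▸ h1)).elim
    · exact (S.fI _ _ _ (h ▸ h1)).elim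
    · rcases S.disj _ _ _ _ _ h h1 with ⟨rfl, rfl⟩ | ⟨rfl, rfl⟩
      · exact (B.arc_irr _ h2).elim
      · exact (B.arc_irr _ h3).elim
    · rcases S.disj _ _ _ _ _ h h1 with ⟨rfl, rfl⟩ | ⟨rfl, rfl⟩
      · exact (B.arc_irr _ h2).elim
      · exact (B.arc_irr _ h3).elim
    · rcases S.disj _ _ _ _ _ h h1 with ⟨rfl, rfl⟩ | ⟨rfl, rfl⟩
      · exact ⟨h2, h3, ⟨_, h⟩, h4⟩
      · exact ⟨h3, h2, ⟨_, h⟩, fun y hy => h4 y (S.symm _ _ _ hy)⟩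
  have s1 := S.symm u v q
  have s2 := S.symm u w q
  have s3 := S.symm v w q
  have hq' : (q = f u ∨ q = f v ∨ q = f w ∨ q ∈ I u v ∨ q ∈ I u w ∨ q ∈ I v w) := hq
  rcases ht with h | h | h | h | h | h
  · exact Or.inl (fin u v w gu hq h)
  · exact Or.inr (Or.inl (fin v u w gv (by tauto) h))
  · exact Or.inr (Or.inr (fin w u v gw (by tauto) h))
  · exact (e1 _ h _ hqt).elim
  · exact (e2 _ h _ hqt).elim
  · exact (e3 _ h _ hqt).elim

lemma Good.nobr (S : Subd (AdjOf arc) f I) {a b : ι} (g : Good arc lt f I a) :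
    ¬ lt (f b) (f a) := by
  intro h
  obtain ⟨i, j, h1, _⟩ := g _ h
  exact S.fI _ _ _ h1

/-- both apexes are the shared vertex `r` -/
lemma sameApex (B : BSet arc lt) (S : Subd (AdjOf arc) f I) {p q r s : ι}
    (hps : p ≠ s) (hqs : q ≠ s) (hpq : p ≠ q)
    (gr : Good arc lt f I r)
    (e1 : ∀ y ∈ I p s, ∀ x, ¬ lt x y) (e2 : ∀ y ∈ I q s, ∀ x, ¬ lt x y)
    (h1 : Apex arc lt f I r p s) (h2 : Apex arc lt f I r q s) : False := by
  have key : ∀ p, p ≠ s → Apex arc lt f I r p s → ∃ y ∈ I p s, arc (f s) y := by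
    intro p hps h
    obtain ⟨y, hy, hy'⟩ := (S.path s p hps.symm).first
    obtain ⟨y0, hy0⟩ := h.2.2.1
    rcases hy' with h' | ⟨_, h'⟩
    · have h' := S.symm _ _ _ h'
      refine ⟨y, h', hy.resolve_right fun ha => ?_⟩
      exact gr.nobr S (B.ax1 _ _ _ (h.2.2.2 _ h') ha)
    · have := S.symm _ _ _ hy0
      rw [h'] at this
      exact this.elim
  obtain ⟨y, hy, hya⟩ := key p hps h1
  obtain ⟨z, hz, hza⟩ := key q hqs h2
  have hne : y ≠ z := by
    rintro rfl
    have := S.disj _ _ _ _ _ hy hz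
    grind
  rcases B.ax3 _ _ _ hya hza hne with h | h
  · exact e2 _ hz _ h
  · exact e1 _ hy _ h

lemma two_tri (B : BSet arc lt) (S : Subd (AdjOf arc) f I) {p q r s : ι}
    (hpq : p ≠ q) (hpr : p ≠ r) (hps : p ≠ s) (hqr : q ≠ r) (hqs : q ≠ s) (hrs : r ≠ s)
    (gp : Good arc lt f I p) (gq : Good arc lt f I q) (gr : Good arc lt f I r)
    (gs : Good arc lt f I s)
    (e1 : ∀ y ∈ I p r, ∀ x, ¬ lt x y) (e2 : ∀ y ∈ I p s, ∀ x, ¬ lt x y)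
    (e3 : ∀ y ∈ I q r, ∀ x, ¬ lt x y) (e4 : ∀ y ∈ I q s, ∀ x, ¬ lt x y)
    (h1 : Apex arc lt f I p r s ∨ Apex arc lt f I r p s ∨ Apex arc lt f I s p r)
    (h2 : Apex arc lt f I q r s ∨ Apex arc lt f I r q s ∨ Apex arc lt f I s q r) : False := by
  have emp : ∀ a b c d e, a ≠ b → AdjOf arc (f a) (f b) → Apex arc lt f I c d e →
      (d = a ∧ e = b) → False := by
    rintro a b c d e hab h h' ⟨rfl, rfl⟩
    obtain ⟨y, hy⟩ := h'.2.2.1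
    rw [(S.path d e hab).adj_empty h] at hy
    exact hy
  rcases h1 with h1 | h1 | h1 <;> rcases h2 with h2 | h2 | h2
  · have hne : f p ≠ f q := fun h => hpq (S.inj _ _ h)
    rcases B.ax3 _ _ _ h1.1 h2.1 hne with h | h
    · exact gq.nobr S h
    · exact gp.nobr S h
  · exact emp r s p r s hrs (Or.inr h2.2.1) h1 ⟨rfl, rfl⟩
  · exact emp r s p r s hrs (Or.inl h2.2.1) h1 ⟨rfl, rfl⟩
  · exact emp r s q r s hrs (Or.inr h1.2.1) h2 ⟨rfl, rfl⟩
  · exact sameApex B S hps hqs hpq gr e2 e4 h1 h2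
  · exact B.arc_asymm h1.2.1 h2.2.1
  · exact emp r s q r s hrs (Or.inl h1.2.1) h2 ⟨rfl, rfl⟩
  · exact B.arc_asymm h1.2.1 h2.2.1
  · exact sameApex B S hpr hqr hpq gs e1 e3 h1 h2

theorem core [Finite X] [Fintype ι] (hc : 5 ≤ Fintype.card ι)
    (B : BSet arc lt) (S : Subd (AdjOf arc) f I) : False := by
  classical
  have ex : ∀ T : Finset ι, T.card ≤ 4 → ∃ z, z ∉ T := by
    intro T hT
    by_contra h
    push Not at h
    have : T = Finset.univ := Finset.eq_univ_iff_forall.2 h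
    rw [this, Finset.card_univ] at hT
    omega
  have h3 : ∀ i j : ι, ∃ z, z ≠ i ∧ z ≠ j := by
    intro i j
    obtain ⟨z, hz⟩ := ex {i, j} (Finset.card_le_two.trans (by norm_num))
    exact ⟨z, by simpa using hz⟩
  obtain ⟨z0, _⟩ := ex ∅ (by simp)
  have hnb : ∃ i0 j0, ∀ i j, ∀ y ∈ I i j, ∀ x, lt x y → (i = i0 ∧ j = j0) ∨ (i = j0 ∧ j = i0) := by
    by_cases h : ∃ i j, ∃ y ∈ I i j, ∃ x, lt x y
    · obtain ⟨i0, j0, q, hq, x, hx⟩ := h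
      refine ⟨i0, j0, fun i j y hy x' hx' => ?_⟩
      by_cases e : q = y
      · subst e; exact S.disj _ _ _ _ _ hq hy
      · exact (B.no2 (nbClaim B S h3 hq hx y i j hy e)
          (nbClaim B S h3 hy hx' q i0 j0 hq (Ne.symm e))).elim
    · push Not at h
      exact ⟨z0, z0, fun i j y hy x hx => (h i j y hy x hx).elim⟩
  obtain ⟨i0, j0, hnb⟩ := hnb
  have hg : ∃ g, ∀ a, a ≠ g → Good arc lt f I a := by
    by_cases h : ∃ g, ¬ Good arc lt f I g
    · obtain ⟨g, hg⟩ := h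
      refine ⟨g, fun a ha => ?_⟩
      by_contra hga
      exact B.no2 ((brClaim B S g).resolve_left hg a ha)
        ((brClaim B S a).resolve_left hga g ha.symm)
    · push Not at h
      exact ⟨z0, fun a _ => h a⟩
  obtain ⟨g, hg⟩ := hg
  obtain ⟨r, hr⟩ := ex {g, i0, j0} (Finset.card_le_three.trans (by norm_num))
  obtain ⟨s, hs⟩ := ex {g, i0, j0, r} Finset.card_le_four
  obtain ⟨p, hp⟩ := ex {g, r, s} (Finset.card_le_three.trans (by norm_num))
  obtain ⟨q, hq⟩ := ex {g, r, s, p} Finset.card_le_four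
  simp only [Finset.mem_insert, Finset.mem_singleton, not_or] at hr hs hp hq
  obtain ⟨hr1, hr2, hr3⟩ := hr
  obtain ⟨hs1, hs2, hs3, hs4⟩ := hs
  obtain ⟨hp1, hp2, hp3⟩ := hp
  obtain ⟨hq1, hq2, hq3, hq4⟩ := hq
  have er : ∀ a, ∀ y ∈ I a r, ∀ x, ¬ lt x y := by
    intro a y hy x hx
    have := hnb _ _ _ hy _ hx
    tauto
  have es : ∀ a, ∀ y ∈ I a s, ∀ x, ¬ lt x y := by
    intro a y hy x hx
    have := hnb _ _ _ hy _ hx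
    tauto
  exact two_tri B S (Ne.symm hq4) hp2 hp3 hq2 hq3 (Ne.symm hs4) (hg p hp1) (hg q hq1) (hg r hr1)
    (hg s hs1) (er p) (es p) (er q) (es q)
    (triangle B S hp2 hp3 (Ne.symm hs4) (hg p hp1) (hg r hr1) (hg s hs1) (er p) (es p) (es r))
    (triangle B S hq2 hq3 (Ne.symm hs4) (hg q hq1) (hg r hr1) (hg s hs1) (er q) (es q) (es r))
end

section
variable {V J : Type}

abbrev NV (V J : Type) := V ⊕ (J × (V ⊕ J))
abbrev NJ (J : Type) := J × J × Bool

def narc (arc : V → V → Prop) (Q : J → V → Prop) : NV V J → NV V J → Prop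
  | .inl u, .inl v => arc u v
  | .inr (s, .inl u), .inr (t, .inl v) => s = t ∧ arc u v
  | .inr (s, .inr r), .inr (t, .inl v) => s = t ∧ Q r v
  | _, _ => False

def nlt (lt : V → V → Prop) (Q : J → V → Prop) : NV V J → NV V J → Prop
  | .inl u, .inl v => lt u v
  | .inr (s, _), .inl v => Q s v
  | .inr (s, .inl u), .inr (t, .inl v) => s = t ∧ lt u v
  | _, _ => False

def nQ (Q : J → V → Prop) : NJ J → NV V J → Prop
  | (s, _, _), .inl v => Q s v
  | (s, r, b), .inr (t, .inl v) => b = true ∧ t = s ∧ Q r v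
  | (s, r, b), .inr (t, .inr r') => b = false ∧ t = s ∧ r' = r

lemma next_bset [Finite V] {arc lt : V → V → Prop} {Q : J → V → Prop} (B : BSet arc lt)
    (up : ∀ i y a, Q i y → lt y a → Q i a)
    (ch : ∀ i x y, Q i x → Q i y → x ≠ y → lt x y ∨ lt y x) :
    BSet (narc arc Q) (nlt lt Q) := by
  obtain ⟨b1, b2, b3, b4, b5, r, hr⟩ := B
  refine ⟨?_, ?_, ?_, ?_, ?_, ?_⟩
  · rintro (x | ⟨s, x | x⟩) <;> simp only [nlt] <;> grind
  · rintro (x | ⟨s, x | x⟩) (y | ⟨t, y | y⟩) (z | ⟨w, z | z⟩) <;> simp only [nlt] <;> grind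
  · rintro (x | ⟨s, x | x⟩) (y | ⟨t, y | y⟩) (z | ⟨w, z | z⟩) <;> simp only [nlt, narc] <;> grind
  · rintro (x | ⟨s, x | x⟩) (y | ⟨t, y | y⟩) (z | ⟨w, z | z⟩) <;> simp only [nlt, narc] <;> grind
  · rintro (x | ⟨s, x | x⟩) (y | ⟨t, y | y⟩) (z | ⟨w, z | z⟩) <;> simp only [nlt, narc] <;> grind
  · obtain ⟨M, hM⟩ := (Set.finite_range r).bddAbove
    refine ⟨fun x => match x with
      | .inl u => r u
      | .inr (_, .inl u) => r u
      | .inr (_, .inr _) => M + 1, ?_⟩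
    have hM : ∀ v, r v ≤ M := fun v => hM ⟨v, rfl⟩
    rintro (x | ⟨s, x | x⟩) (y | ⟨t, y | y⟩) <;> simp only [narc] <;> grind

lemma next_up {lt : V → V → Prop} {Q : J → V → Prop}
    (up : ∀ i y a, Q i y → lt y a → Q i a) :
    ∀ i y a, nQ Q i y → nlt lt Q y a → nQ Q i a := by
  rintro ⟨i, j, b⟩ (x | ⟨s, x | x⟩) (y | ⟨t, y | y⟩) <;> simp only [nlt, nQ] <;> grind

lemma next_ch {lt : V → V → Prop} {Q : J → V → Prop}
    (ch : ∀ i x y, Q i x → Q i y → x ≠ y → lt x y ∨ lt y x) :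
    ∀ i x y, nQ Q i x → nQ Q i y → x ≠ y → nlt lt Q x y ∨ nlt lt Q y x := by
  rintro ⟨i, j, b⟩ (x | ⟨s, x | x⟩) (y | ⟨t, y | y⟩) <;> simp only [nlt, nQ] <;> grind

lemma next_col {arc : V → V → Prop} {Q : J → V → Prop} {k : ℕ}
    (col : ∀ c : V → ℕ, (∀ x y, arc x y → c x ≠ c y) →
      ∃ i, ∃ F : Finset ℕ, F.card = k ∧ ∀ a ∈ F, ∃ v, Q i v ∧ c v = a) :
    ∀ c : NV V J → ℕ, (∀ x y, narc arc Q x y → c x ≠ c y) →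
      ∃ i, ∃ F : Finset ℕ, F.card = k + 1 ∧ ∀ a ∈ F, ∃ v, nQ Q i v ∧ c v = a := by
  intro c hc
  obtain ⟨s, F, hF, hFa⟩ := col (fun v => c (.inl v)) (fun x y h => hc _ _ h)
  obtain ⟨r, E, hE, hEa⟩ := col (fun v => c (.inr (s, .inl v))) (fun x y h => hc _ _ ⟨rfl, h⟩)
  by_cases hs : E ⊆ F
  · have : E = F := Finset.eq_of_subset_of_card_le hs (by omega)
    subst this
    refine ⟨(s, r, false), insert (c (.inr (s, .inr r))) E, ?_, ?_⟩
    · rw [Finset.card_insert_of_notMem, hF]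
      intro h
      obtain ⟨v, hv, hcv⟩ := hEa _ h
      exact hc (.inr (s, .inr r)) (.inr (s, .inl v)) ⟨rfl, hv⟩ hcv.symm
    · intro a ha
      rw [Finset.mem_insert] at ha
      rcases ha with rfl | ha
      · exact ⟨.inr (s, .inr r), ⟨rfl, rfl, rfl⟩, rfl⟩
      · obtain ⟨v, hv, hcv⟩ := hFa _ ha
        exact ⟨.inl v, hv, hcv⟩
  · obtain ⟨a0, h1, h2⟩ := Finset.not_subset.1 hs
    refine ⟨(s, r, true), insert a0 F, ?_, ?_⟩
    · rw [Finset.card_insert_of_notMem h2, hF]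
    · intro a ha
      rw [Finset.mem_insert] at ha
      rcases ha with rfl | ha
      · obtain ⟨v, hv, hcv⟩ := hEa _ h1
        exact ⟨.inr (s, .inl v), ⟨rfl, rfl, hv⟩, hcv⟩
      · obtain ⟨v, hv, hcv⟩ := hFa _ ha
        exact ⟨.inl v, hv, hcv⟩
end

lemma levels (k : ℕ) : ∃ (V J : Type) (_ : Finite V) (_ : Finite J) (arc lt : V → V → Prop)
    (Q : J → V → Prop), BSet arc lt ∧ (∀ i y a, Q i y → lt y a → Q i a) ∧
    (∀ i x y, Q i x → Q i y → x ≠ y → lt x y ∨ lt y x) ∧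
    (∀ c : V → ℕ, (∀ x y, arc x y → c x ≠ c y) →
      ∃ i, ∃ F : Finset ℕ, F.card = k ∧ ∀ a ∈ F, ∃ v, Q i v ∧ c v = a) := by
  induction k with
  | zero =>
    refine ⟨Unit, Unit, inferInstance, inferInstance, fun _ _ => False, fun _ _ => False,
      fun _ _ => True, ⟨by simp, by simp, by simp, by simp, by simp, ⟨fun _ => 0, by simp⟩⟩,
      by simp, ?_, ?_⟩
    · intro i x y _ _ h
      exact (h rfl).elim
    · intro c _
      exact ⟨(), ∅, rfl, by simp⟩
  | succ k ih =>
    obtain ⟨V, J, hV, hJ, arc, lt, Q, B, up, ch, col⟩ := ih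
    exact ⟨NV V J, NJ J, inferInstance, inferInstance, narc arc Q, nlt lt Q, nQ Q,
      next_bset B up ch, next_up up, next_ch ch, next_col col⟩


lemma spath {W : Type} {adj : W → W → Prop} (sy : ∀ x y, adj x y → adj y x)
    (irr : ∀ x, ¬ adj x x) (U : Set W) {a b : W} (hab : a ≠ b)
    (h : ∃ (l : ℕ) (g : ℕ → W), g 0 = a ∧ g l = b ∧ (∀ k, k < l → adj (g k) (g (k+1))) ∧
      ∀ k, k ≤ l → g k ∈ U) :
    ∃ I : Set W, IPath adj a b I ∧ I ⊆ U ∧ a ∉ I ∧ b ∉ I := by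
  classical
  obtain ⟨g, h0, h1, h2, h3⟩ := Nat.find_spec h
  have hmin := fun l => @Nat.find_min _ _ h l
  generalize Nat.find h = l at *
  have hl : 1 ≤ l := by
    rcases Nat.eq_zero_or_pos l with e | e
    · subst e; exact (hab (h0.symm.trans h1)).elim
    · exact e
  have splice : ∀ k d, 1 ≤ d → k + d ≤ l → (k + d < l → adj (g k) (g (k + 1 + d))) →
      (k + d = l → g k = g l) → False := by
    intro k d hd hkd ha he
    refine hmin (l - d) (by omega) ⟨fun t => if t ≤ k then g t else g (t + d), ?_, ?_, ?_, ?_⟩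
    · simp [h0]
    · show (if l - d ≤ k then g (l - d) else g (l - d + d)) = b
      split_ifs with c
      · have : l - d = k := by omega
        rw [this, he (by omega), h1]
      · rw [show l - d + d = l by omega, h1]
    · intro t ht
      show adj (if t ≤ k then g t else g (t + d)) (if t + 1 ≤ k then g (t+1) else g (t + 1 + d))
      split_ifs with c1 c2 c2
      · exact h2 _ (by omega)
      · have : t = k := by omega
        subst this
        exact ha (by omega)
      · omega
      · have := h2 (t + d) (by omega)
        rwa [show t + d + 1 = t + 1 + d by omega] at this
    · intro t ht
      show (if t ≤ k then g t else g (t + d)) ∈ U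
      split_ifs with c
      · exact h3 _ (by omega)
      · exact h3 _ (by omega)
  have inj : ∀ k m, k < m → m ≤ l → g k ≠ g m := by
    intro k m hk hm e
    refine splice k (m - k) (by omega) (by omega) ?_ ?_
    · intro hlt
      have := h2 m (by omega)
      rw [← e] at this
      rwa [show k + 1 + (m - k) = m + 1 by omega]
    · intro h
      rw [e]
      congr 1
      omega
  have hadj : ∀ k m, k < m → m ≤ l → adj (g k) (g m) → m = k + 1 := by
    intro k m hk hm e
    by_contra hne
    refine splice k (m - k - 1) (by omega) (by omega) ?_ ?_
    · intro _
      rwa [show k + 1 + (m - k - 1) = m by omega]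
    · intro _
      omega
  refine ⟨{x | ∃ k, 0 < k ∧ k < l ∧ g k = x}, ⟨l, g, hl, h0, h1, h2, ?_, ?_, fun x => Iff.rfl⟩,
    ?_, ?_, ?_⟩
  · intro k m hk hm e
    rcases lt_trichotomy k m with c | c | c
    · exact Or.inl (hadj k m c hm e)
    · subst c; exact (irr _ e).elim
    · exact Or.inr (hadj m k c hk (sy _ _ e))
  · intro k m hk hm e
    rcases lt_trichotomy k m with c | c | c
    · exact (inj k m c hm e).elim
    · exact c
    · exact (inj m k c hk e.symm).elim
  · rintro x ⟨k, c1, c2, rfl⟩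
    exact h3 _ c2.le
  · rintro ⟨k, c1, c2, e⟩
    exact inj 0 k c1 c2.le (h0.trans e.symm)
  · rintro ⟨k, c1, c2, e⟩
    exact inj k l c2 le_rfl (e.trans h1.symm)

lemma IPath.sub {W : Type} {adj : W → W → Prop} {a b : W} {I : Set W} (h : IPath adj a b I)
    (S : Set W) (ha : a ∈ S) (hb : b ∈ S) (hI : I ⊆ S) :
    IPath (fun x y : S => adj x y) ⟨a, ha⟩ ⟨b, hb⟩ {x | (x : W) ∈ I} := by
  obtain ⟨l, g, hl, h0, h1, h2, h3, h4, h5⟩ := h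
  have hm : ∀ k, g (min k l) ∈ S := by
    intro k
    rcases Nat.eq_zero_or_pos k with e | e
    · subst e; simpa [h0] using ha
    · rcases lt_or_ge k l with c | c
      · rw [min_eq_left c.le]
        exact hI ((h5 _).2 ⟨k, e, c, rfl⟩)
      · rw [min_eq_right c, h1]; exact hb
  refine ⟨l, fun k => ⟨g (min k l), hm k⟩, hl, ?_, ?_, ?_, ?_, ?_, ?_⟩
  · apply Subtype.ext; simpa using h0
  · apply Subtype.ext; simpa using h1
  · intro k hk
    show adj (g (min k l)) (g (min (k+1) l))
    rw [min_eq_left hk.le, min_eq_left hk]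
    exact h2 k hk
  · intro k m hk hm h
    apply h3 k m hk hm
    change adj (g (min k l)) (g (min m l)) at h
    rwa [min_eq_left hk, min_eq_left hm] at h
  · intro k m hk hm h
    apply h4 k m hk hm
    have h := congrArg Subtype.val h
    change (g (min k l)) = (g (min m l)) at h
    rwa [min_eq_left hk, min_eq_left hm] at h
  · rintro ⟨x, hx⟩
    show x ∈ I ↔ _
    rw [h5]
    constructor
    · rintro ⟨k, c1, c2, e⟩
      refine ⟨k, c1, c2, Subtype.ext ?_⟩
      show g (min k l) = x
      rwa [min_eq_left c2.le]
    · rintro ⟨k, c1, c2, e⟩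
      have h := congrArg Subtype.val e
      change (g (min k l)) = x at h
      rw [min_eq_left c2.le] at h
      exact ⟨k, c1, c2, h⟩

lemma no_subdiv {W : Type} [Finite W] {n : ℕ} (hn : 5 ≤ n) (H : SimpleGraph W)
    {arc lt : W → W → Prop} (B : BSet arc lt) (hH : ∀ x y, H.Adj x y ↔ AdjOf arc x y)
    (hs : IsSubdivision H (⊤ : SimpleGraph (Fin n))) : False := by
  classical
  obtain ⟨f, P, hP1, hP2, hP3, hP4, hP5⟩ := hs
  let U : Fin n → Fin n → Set W := fun i j =>
    {x | ∃ u v, ∃ h : (⊤ : SimpleGraph (Fin n)).Adj u v, s(u, v) = s(i, j) ∧ x ∈ (P h).support}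
  have U2 : ∀ i j k, f k ∈ U i j → k = i ∨ k = j := by
    rintro i j k ⟨u, v, h, e, hk⟩
    have := hP2 h k hk
    rw [Sym2.eq_iff] at e
    grind
  have U3 : ∀ i j k l x, x ∈ U i j → x ∈ U k l → (∀ z, x ≠ f z) → s(i, j) = s(k, l) := by
    rintro i j k l x ⟨u, v, h, e, hx⟩ ⟨u', v', h', e', hx'⟩ hz
    by_contra hne
    obtain ⟨z, h⟩ := hP3 h h' (by rwa [e, e']) x hx hx'
    exact hz z h
  have ex : ∀ i j, ∃ I : Set W, i ≠ j →
      IPath (AdjOf arc) (f i) (f j) I ∧ I ⊆ U i j ∧ f i ∉ I ∧ f j ∉ I := by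
    intro i j
    by_cases hij : i = j
    · exact ⟨∅, fun h => (h hij).elim⟩
    have hA : (⊤ : SimpleGraph (Fin n)).Adj i j := hij
    obtain ⟨I, hI⟩ := spath (adj := AdjOf arc) AdjOf.sy
      (fun x h => h.elim (B.arc_irr x) (B.arc_irr x)) (U i j)
      (a := f i) (b := f j) (fun h => hij (f.injective h))
      ⟨(P hA).length, (P hA).getVert, by simp, by simp,
        fun k hk => (hH _ _).1 ((P hA).adj_getVert_succ hk),
        fun k hk => ⟨i, j, hA, rfl, (P hA).getVert_mem_support k⟩⟩
    exact ⟨I, fun _ => hI⟩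
  choose I0 hI0 using ex
  let I : Fin n → Fin n → Set W := fun i j => {x | i ≠ j ∧ x ∈ I0 (min i j) (max i j)}
  have Isym : ∀ i j x, x ∈ I i j → x ∈ I j i := by
    rintro i j x ⟨h1, h2⟩
    exact ⟨h1.symm, by rwa [min_comm, max_comm]⟩
  have Ilt : ∀ i j, i < j → I i j = I0 i j := by
    intro i j h
    ext x
    show (i ≠ j ∧ x ∈ I0 (min i j) (max i j)) ↔ _
    rw [min_eq_left h.le, max_eq_right h.le]
    exact ⟨And.right, fun hx => ⟨h.ne, hx⟩⟩
  have Usym : ∀ i j, U i j = U j i := by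
    intro i j
    show {x | ∃ u v, ∃ h : (⊤ : SimpleGraph (Fin n)).Adj u v, s(u, v) = s(i, j) ∧
      x ∈ (P h).support} = _
    rw [Sym2.eq_swap (a := i)]
  have Ieq : ∀ i j, I i j = I j i := fun i j => Set.ext fun x => ⟨Isym _ _ _, Isym _ _ _⟩
  have main : ∀ i j, i ≠ j →
      IPath (AdjOf arc) (f i) (f j) (I i j) ∧ I i j ⊆ U i j ∧ f i ∉ I i j ∧ f j ∉ I i j := by
    intro i j hij
    rcases lt_or_gt_of_ne hij with h | h
    · rw [Ilt _ _ h]; exact hI0 i j hij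
    · rw [Ieq, Usym, Ilt _ _ h]
      obtain ⟨a, b, c, d⟩ := hI0 j i hij.symm
      exact ⟨a.rev AdjOf.sy, b, d, c⟩
  have fI : ∀ i j k, f k ∉ I i j := by
    intro i j k hk
    obtain ⟨a, b, c, d⟩ := main i j hk.1
    rcases U2 i j k (b hk) with rfl | rfl
    · exact c hk
    · exact d hk
  have IU : ∀ i j x, x ∈ I i j → x ∈ U i j := fun i j x hx => (main i j hx.1).2.1 hx
  have disj : ∀ i j k l x, x ∈ I i j → x ∈ U k l → (k = i ∧ l = j) ∨ (k = j ∧ l = i) := by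
    intro i j k l x h1 h2
    have := U3 i j k l x (IU _ _ _ h1) h2 (by rintro z rfl; exact fI _ _ _ h1)
    rw [Sym2.eq_iff] at this
    grind
  let S : Set W := {x | (∃ i, x = f i) ∨ ∃ i j, x ∈ I i j}
  let f' : Fin n → S := fun i => ⟨f i, Or.inl ⟨i, rfl⟩⟩
  let I' : Fin n → Fin n → Set S := fun i j => {x | (x : W) ∈ I i j}
  have B' : BSet (fun x y : S => arc x y) (fun x y : S => lt x y) := by
    obtain ⟨b1, b2, b3, b4, b5, r, hr⟩ := B
    exact ⟨fun x => b1 x, fun x y z => b2 x y z, fun x y z => b3 x y z, fun x y z => b4 x y z,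
      fun x y z h h' hn => b5 x y z h h' (fun e => hn (Subtype.ext e)),
      fun x => r x, fun x y h => hr _ _ h⟩
  refine core (f := f') (I := I') (by simpa using hn) B' ⟨?_, ?_, ?_, ?_, ?_, ?_, ?_, ?_⟩
  · intro i j h
    exact f.injective (congrArg Subtype.val h)
  · rintro ⟨x, ⟨i, hi⟩ | h⟩
    · exact Or.inl ⟨i, Subtype.ext hi⟩
    · exact Or.inr h
  · intro i j x h
    exact h.1
  · intro i j x h
    exact Isym _ _ _ h
  · intro i j hij
    exact (main i j hij).1.sub S _ _ (fun x hx => Or.inr ⟨i, j, hx⟩)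
  · intro i j k h
    exact fI i j k h
  · intro i j k l x h h'
    exact disj i j k l x h (IU _ _ _ h')
  · rintro i j ⟨x, hxS⟩ ⟨y, hyS⟩ hx hxy
    change x ∈ I i j at hx
    have hxy : H.Adj x y := (hH _ _).2 hxy
    obtain ⟨u, v, h, he⟩ := hP5 hxy
    have hxu : x ∈ U u v := ⟨u, v, h, rfl, (P h).fst_mem_support_of_mem_edges he⟩
    have hyu : y ∈ U u v := ⟨u, v, h, rfl, (P h).snd_mem_support_of_mem_edges he⟩
    have hyij : y ∈ U i j := by
      rcases disj _ _ _ _ _ hx hxu with ⟨rfl, rfl⟩ | ⟨rfl, rfl⟩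
      · exact hyu
      · rwa [Usym]
    rcases hyS with ⟨k, rfl⟩ | ⟨k, l, hy⟩
    · right
      rcases U2 _ _ _ hyij with rfl | rfl
      · exact Or.inl rfl
      · exact Or.inr rfl
    · left
      show y ∈ I i j
      rcases disj _ _ _ _ _ hy hyij with ⟨rfl, rfl⟩ | ⟨rfl, rfl⟩
      · exact hy
      · exact Isym _ _ _ hy

lemma main_aux (n : ℕ) (hn : 5 ≤ n) :
    ¬ WeaklyPervasive (⊤ : SimpleGraph (Fin n)) := by
  classical
  rintro ⟨b, hb⟩
  let N := b 0 + b 1 + b 2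
  obtain ⟨V, J, hV, hJ, arc, lt, Q, B, up, ch, col⟩ := levels (N + 1)
  let G : SimpleGraph V := 
    { Adj := AdjOf arc
      symm := ⟨fun x y h => AdjOf.sy x y h⟩
      loopless := ⟨fun x h => h.elim (B.arc_irr x) (B.arc_irr x)⟩ }
  have hF : InForbs (⊤ : SimpleGraph (Fin n)) G := by
    rintro U S hS ⟨e, he⟩
    have : Finite U := Finite.of_injective e e.injective
    refine no_subdiv hn S (arc := fun x y => arc (e x) (e y)) (lt := fun x y => lt (e x) (e y))
      ?_ he hS
    obtain ⟨b1, b2, b3, b4, b5, r, hr⟩ := B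
    exact ⟨fun x => b1 _, fun x y z => b2 _ _ _, fun x y z => b3 _ _ _, fun x y z => b4 _ _ _,
      fun x y z h h' hn => b5 _ _ _ h h' (fun c => hn (e.injective c)),
      fun x => r (e x), fun x y h => hr _ _ h⟩
  have src : ∀ x y z, arc x y → arc x z → G.Adj y z → False := by
    intro x y z h1 h2 h3
    rcases B.ax3 _ _ _ h1 h2 h3.ne with h | h
    · exact B.nonadj h h3
    · exact B.nonadj h h3.symm
  have tri : ∀ x y z, G.Adj x y → G.Adj x z → G.Adj y z → False := by
    intro x y z h1 h2 h3
    obtain ⟨r, hr⟩ := B.rk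
    rcases id h1 with a | a <;> rcases id h2 with c | c <;> rcases id h3 with d | d
    · exact src _ _ _ a c h3
    · exact src _ _ _ a c h3
    · have := hr _ _ a; have := hr _ _ c; have := hr _ _ d; omega
    · exact src _ _ _ c d h1
    · exact src _ _ _ a d h2
    · have := hr _ _ a; have := hr _ _ c; have := hr _ _ d; omega
    · exact src _ _ _ a d h2
    · exact src _ _ _ c d h1
  have hcl : cliqueNumber G ≤ 2 := by
    apply csSup_le'
    rintro m ⟨s, hs⟩
    by_contra hm
    push Not at hm
    have : 2 < s.card := by rw [hs.card_eq]; exact hm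
    obtain ⟨x, y, z, hx, hy, hz, h1, h2, h3⟩ := Finset.two_lt_card_iff.1 this
    exact tri x y z (hs.isClique hx hy h1) (hs.isClique hx hz h2) (hs.isClique hy hz h3)
  have hbN : b (cliqueNumber G) ≤ N := by
    have : cliqueNumber G = 0 ∨ cliqueNumber G = 1 ∨ cliqueNumber G = 2 := by omega
    rcases this with h | h | h <;> rw [h] <;> omega
  have hc : G.Colorable N := by
    rw [← SimpleGraph.chromaticNumber_le_iff_colorable]
    exact (hb V (Fintype.ofFinite V) G hF).trans (by exact_mod_cast hbN)
  obtain ⟨C⟩ := hc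
  obtain ⟨i, F, hFc, hFa⟩ := col (fun v => (C v : ℕ)) (by
    intro x y h e
    exact C.valid (show G.Adj x y from Or.inl h) (Fin.ext e))
  have : F ⊆ Finset.range N := by
    intro a ha
    obtain ⟨v, _, rfl⟩ := hFa a ha
    exact Finset.mem_range.2 (C v).2
  have := Finset.card_le_card this
  rw [Finset.card_range] at this
  omega

/-- `K_n` is not weakly pervasive for every `n ≥ 5`. -/
theorem Kn_not_weaklyPervasive (n : ℕ) (hn : 5 ≤ n) :
    ¬ WeaklyPervasive (⊤ : SimpleGraph (Fin n)) :=
  main_aux n hn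

end BurlingFormal
end
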